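/- arXiv:2503.22258 — 10 statements merged into one kernel-verified Lean document; each statement's English description precedes it below -/
import Mathlib

section
/- Let G : ℝ^d → [0,∞) be locally bounded and weakly convex with modulus ρ_G > 0. Then for every t ∈ (0, 1/ρ_G) the gradient ∇M_G^t of the Moreau envelope is Lipschitz continuous on ℝ^d with Lipschitz constant (2 − ρ_G t)/(t(1 − ρ_G t)). -/
noncomputable section

variable {d : ℕ}

/-- Moreau envelope `M_G^t(x) = inf_y G(y) + ‖x-y‖²/(2t)` (with `M_G^0 := G`). -/
noncomputable def moreau (G : EuclideanSpace ℝ (Fin d) → ℝ) (t : ℝ)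
    (x : EuclideanSpace ℝ (Fin d)) : ℝ :=
  if t = 0 then G x else ⨅ y : EuclideanSpace ℝ (Fin d), (G y + ‖x - y‖ ^ 2 / (2 * t))

/-- `G` is locally bounded: bounded above on a neighborhood of every point. -/
def LocBdd (G : EuclideanSpace ℝ (Fin d) → ℝ) : Prop :=
  ∀ x : EuclideanSpace ℝ (Fin d), ∃ U ∈ nhds x, BddAbove (G '' U)

theorem prox_exists (G : EuclideanSpace ℝ (Fin d) → ℝ) (hG0 : ∀ x, 0 ≤ G x)
    (ρG : ℝ)
    (hwc : ConvexOn ℝ Set.univ (fun y => G y + ρG / 2 * ‖y‖ ^ 2)) (t : ℝ) (ht : 0 < t)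
    (x : EuclideanSpace ℝ (Fin d)) :
    ∃ p, ∀ y, G p + ‖x - p‖ ^ 2 / (2 * t) ≤ G y + ‖x - y‖ ^ 2 / (2 * t) := by
  have hc : Continuous (fun y => G y + ρG / 2 * ‖y‖ ^ 2) := by
    rw [← continuousOn_univ]
    exact hwc.continuousOn isOpen_univ
  have hGc : Continuous G := by
    have : G = fun y => (G y + ρG / 2 * ‖y‖ ^ 2) - ρG / 2 * ‖y‖ ^ 2 := by
      funext y; ring
    rw [this]
    exact hc.sub (by fun_prop)
  have hcont : Continuous (fun y => G y + ‖x - y‖ ^ 2 / (2 * t)) :=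
    hGc.add (by fun_prop)
  refine hcont.exists_forall_le' x ?_
  have hA : 0 ≤ 2 * t * G x := by have := hG0 x; positivity
  filter_upwards [(isCompact_closedBall x (2 * t * G x + 1)).compl_mem_cocompact] with y hy
  have hy' : 2 * t * G x + 1 < ‖x - y‖ := by
    simpa [dist_eq_norm, norm_sub_rev] using hy
  have h1 : 2 * t * G x ≤ ‖x - y‖ ^ 2 := by nlinarith
  have h2 : G x ≤ ‖x - y‖ ^ 2 / (2 * t) := by
    rw [le_div_iff₀ (by positivity)]; linarith
  have := hG0 y
  simp only [sub_self, norm_zero]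
  norm_num
  linarith

theorem prox_strong (G : EuclideanSpace ℝ (Fin d) → ℝ)
    (ρG : ℝ)
    (hwc : ConvexOn ℝ Set.univ (fun y => G y + ρG / 2 * ‖y‖ ^ 2)) (t : ℝ) (ht : 0 < t)
    (x p : EuclideanSpace ℝ (Fin d))
    (hp : ∀ y, G p + ‖x - p‖ ^ 2 / (2 * t) ≤ G y + ‖x - y‖ ^ 2 / (2 * t))
    (y : EuclideanSpace ℝ (Fin d)) :
    G p + ‖x - p‖ ^ 2 / (2 * t) + (1 / t - ρG) / 2 * ‖y - p‖ ^ 2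
      ≤ G y + ‖x - y‖ ^ 2 / (2 * t) := by
  have key : ∀ l ∈ Set.Ioo (0 : ℝ) 1,
      G p + ‖x - p‖ ^ 2 / (2 * t) + (1 / t - ρG) / 2 * (1 - l) * ‖y - p‖ ^ 2
      ≤ G y + ‖x - y‖ ^ 2 / (2 * t) := by
    intro l hl
    obtain ⟨hl0, hl1⟩ := hl
    have h1 := hwc.2 (Set.mem_univ p) (Set.mem_univ y) (by linarith : 0 ≤ 1 - l) hl0.le (by ring)
    have h2 := hp ((1 - l) • p + l • y)
    simp only [smul_eq_mul] at h1
    have e1 : ‖(1 - l) • p + l • y‖ ^ 2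
        = (1 - l) * ‖p‖ ^ 2 + l * ‖y‖ ^ 2 - l * (1 - l) * ‖y - p‖ ^ 2 := by
      simp only [← real_inner_self_eq_norm_sq, inner_add_left, inner_add_right, inner_sub_left,
        inner_sub_right, real_inner_smul_left, real_inner_smul_right, real_inner_comm p y]
      ring
    have e2 : ‖x - ((1 - l) • p + l • y)‖ ^ 2
        = (1 - l) * ‖x - p‖ ^ 2 + l * ‖x - y‖ ^ 2 - l * (1 - l) * ‖y - p‖ ^ 2 := by
      simp only [← real_inner_self_eq_norm_sq, inner_add_left, inner_add_right, inner_sub_left,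
        inner_sub_right, real_inner_smul_left, real_inner_smul_right, real_inner_comm p y,
        real_inner_comm x y, real_inner_comm x p]
      ring
    rw [e1] at h1
    rw [e2] at h2
    refine le_of_mul_le_mul_left ?_ hl0
    have e3 : 1 / t = 2 * (1 / (2 * t)) := by field_simp
    rw [e3]
    rw [div_eq_mul_one_div _ (2 * t), div_eq_mul_one_div (_ - _) (2 * t)] at h2
    rw [div_eq_mul_one_div (‖x - p‖ ^ 2) (2 * t), div_eq_mul_one_div (‖x - y‖ ^ 2) (2 * t)]
    linarith
  have hcl : Filter.Tendsto (fun l : ℝ =>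
      G p + ‖x - p‖ ^ 2 / (2 * t) + (1 / t - ρG) / 2 * (1 - l) * ‖y - p‖ ^ 2)
      (nhdsWithin 0 (Set.Ioi 0))
      (nhds (G p + ‖x - p‖ ^ 2 / (2 * t) + (1 / t - ρG) / 2 * (1 - 0) * ‖y - p‖ ^ 2)) := by
    apply Filter.Tendsto.mono_left _ nhdsWithin_le_nhds
    apply Continuous.tendsto (f := fun l : ℝ =>
      G p + ‖x - p‖ ^ 2 / (2 * t) + (1 / t - ρG) / 2 * (1 - l) * ‖y - p‖ ^ 2)
    fun_prop
  have := le_of_tendsto hcl (by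
    filter_upwards [Ioo_mem_nhdsGT (zero_lt_one (α := ℝ))] with l hl using key l hl)
  simpa using this

/-- for `t ∈ (0, 1/ρ_G)` the gradient of the Moreau envelope is Lipschitz
continuous with constant `(2 − ρ_G t)/(t(1 − ρ_G t))`. -/
theorem moreau_gradient_lipschitz
    (G : EuclideanSpace ℝ (Fin d) → ℝ) (hG0 : ∀ x, 0 ≤ G x) (hloc : LocBdd G)
    (ρG : ℝ) (hρ : 0 < ρG)
    (hwc : ConvexOn ℝ Set.univ (fun y => G y + ρG / 2 * ‖y‖ ^ 2)) :
    ∀ t ∈ Set.Ioo (0 : ℝ) (1 / ρG),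
      ∃ g : EuclideanSpace ℝ (Fin d) → EuclideanSpace ℝ (Fin d),
        (∀ x, HasGradientAt (moreau G t) (g x) x) ∧
        LipschitzWith (Real.toNNReal ((2 - ρG * t) / (t * (1 - ρG * t)))) g := by
  intro t ht
  obtain ⟨ht0, ht1⟩ := ht
  have hs : 0 < 1 - ρG * t := by
    rw [lt_div_iff₀ hρ] at ht1; linarith
  choose P hP using prox_exists G hG0 ρG hwc t ht0
  have hM : ∀ x, moreau G t x = G (P x) + ‖x - P x‖ ^ 2 / (2 * t) := by
    intro x
    rw [moreau, if_neg ht0.ne']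
    exact le_antisymm (ciInf_le ⟨_, by rintro _ ⟨y, rfl⟩; exact hP x y⟩ (P x))
      (le_ciInf (hP x))
  have hPL : ∀ x z, (1 - ρG * t) * ‖P x - P z‖ ≤ ‖x - z‖ := by
    intro x z
    have h1 := prox_strong G ρG hwc t ht0 x (P x) (hP x) (P z)
    have h2 := prox_strong G ρG hwc t ht0 z (P z) (hP z) (P x)
    rw [norm_sub_rev (P z) (P x)] at h1
    have h3 : (1 - ρG * t) * ‖P x - P z‖ ^ 2 ≤ inner ℝ (x - z) (P x - P z) := by
      have e : inner ℝ (x - z) (P x - P z) =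
          (‖x - P z‖ ^ 2 + ‖z - P x‖ ^ 2 - ‖x - P x‖ ^ 2 - ‖z - P z‖ ^ 2) / 2 := by
        simp only [← real_inner_self_eq_norm_sq, inner_sub_left,
          inner_sub_right, real_inner_comm x, real_inner_comm z]
        ring
      rw [e]
      have h4 := mul_le_mul_of_nonneg_left (add_le_add h1 h2) ht0.le
      field_simp at h4
      nlinarith
    have h5 := real_inner_le_norm (x - z) (P x - P z)
    rcases (norm_nonneg (P x - P z)).eq_or_lt with h0 | h0
    · rw [← h0]; simp
    · refine le_of_mul_le_mul_right ?_ h0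
      nlinarith
  set L := (2 - ρG * t) / (t * (1 - ρG * t)) with hL
  have hL0 : 0 ≤ L := div_nonneg (by linarith) (by positivity)
  have hgL : ∀ x z, ‖(1 / t) • (x - P x) - (1 / t) • (z - P z)‖ ≤ L * ‖x - z‖ := by
    intro x z
    rw [← smul_sub, norm_smul, Real.norm_of_nonneg (by positivity)]
    have h1 : ‖x - P x - (z - P z)‖ ≤ ‖x - z‖ + ‖P x - P z‖ := by
      rw [sub_sub_sub_comm]; exact norm_sub_le _ _
    have h2 : ‖P x - P z‖ ≤ ‖x - z‖ / (1 - ρG * t) := by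
      rw [le_div_iff₀ hs]; linarith [hPL x z]
    calc 1 / t * ‖x - P x - (z - P z)‖ ≤ 1 / t * (‖x - z‖ + ‖x - z‖ / (1 - ρG * t)) := by
          gcongr; linarith
      _ = L * ‖x - z‖ := by
          have hs1 : 1 - ρG * t ≠ 0 := hs.ne'
          have hL1 : L = 1 / t * (1 + 1 / (1 - ρG * t)) := by
            rw [hL, div_eq_iff (mul_ne_zero ht0.ne' hs1), one_add_div hs1,
              div_mul_div_comm, div_mul_cancel₀ _ (mul_ne_zero ht0.ne' hs1)]
            ring
          rw [hL1]; ring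
  refine ⟨fun x => (1 / t) • (x - P x), ?_, ?_⟩
  · intro x
    have hup : ∀ x z, moreau G t z - moreau G t x ≤
        inner ℝ ((1 / t) • (x - P x)) (z - x) + 1 / (2 * t) * ‖z - x‖ ^ 2 := by
      intro x z
      have h1 := hP z (P x)
      rw [hM, hM]
      have e : inner ℝ ((1 / t) • (x - P x)) (z - x) + 1 / (2 * t) * ‖z - x‖ ^ 2
          = ‖z - P x‖ ^ 2 / (2 * t) - ‖x - P x‖ ^ 2 / (2 * t) := by
        rw [real_inner_smul_left]
        have : ‖z - P x‖ ^ 2 = ‖x - P x‖ ^ 2 + 2 * inner ℝ (x - P x) (z - x) + ‖z - x‖ ^ 2 := by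
          rw [← norm_add_sq_real]; congr 2; abel
        rw [this]; field_simp; ring
      rw [e]; linarith
    have hbd : ∀ z, ‖moreau G t z - moreau G t x - inner ℝ ((1 / t) • (x - P x)) (z - x)‖
        ≤ (L + 1 / (2 * t)) * ‖z - x‖ ^ 2 := by
      intro z
      have h1 := hup x z
      have h2 := hup z x
      have h3 := abs_le.1 (abs_real_inner_le_norm
        ((1 / t) • (z - P z) - (1 / t) • (x - P x)) (z - x))
      have h4 := mul_le_mul_of_nonneg_right (hgL z x) (norm_nonneg (z - x))
      have h5 := inner_sub_left (𝕜 := ℝ) ((1 / t) • (z - P z)) ((1 / t) • (x - P x)) (z - x)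
      have h6 : inner ℝ ((1 / t) • (z - P z)) (x - z)
          = - inner ℝ ((1 / t) • (z - P z)) (z - x) := by
        rw [← inner_neg_right, neg_sub]
      rw [norm_sub_rev x z] at h2
      have h7 : 0 ≤ L * ‖z - x‖ ^ 2 := by positivity
      rw [Real.norm_eq_abs, abs_le]
      constructor <;> nlinarith
    rw [hasGradientAt_iff_isLittleO]
    have hO : (fun z => moreau G t z - moreau G t x - inner ℝ ((1 / t) • (x - P x)) (z - x))
        =O[nhds x] fun z => ‖z - x‖ ^ 2 := by
      refine Asymptotics.IsBigO.of_bound (L + 1 / (2 * t)) (Filter.Eventually.of_forall ?_)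
      intro z
      have := hbd z
      rwa [Real.norm_of_nonneg (by positivity : 0 ≤ ‖z - x‖ ^ 2)]
    exact hO.trans_isLittleO (Asymptotics.isLittleO_pow_sub_sub x one_lt_two)
  · refine LipschitzWith.of_dist_le_mul fun x z => ?_
    rw [dist_eq_norm, dist_eq_norm, Real.coe_toNNReal _ hL0]
    exact hgL x z
end
end

section
/- Let G : ℝ^d → [0,∞) be locally bounded and weakly convex with modulus ρ_G > 0. Then for every t > 0 the proximal map of G is coercive in the sense that lim_{R→∞} inf_{‖x‖ ≥ R} inf_{p ∈ prox_{tG}(x)} ‖p‖ = ∞; that is, for every C > 0 there exists R > 0 such that ‖x‖ ≥ R and p ∈ prox_{tG}(x) imply ‖p‖ ≥ C. -/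
noncomputable section

variable {d : ℕ}

/-- Proximal map `prox_{tG}(x)` as the set of minimizers of `y ↦ G(y) + ‖x-y‖²/(2t)`. -/
def proxSet (G : EuclideanSpace ℝ (Fin d) → ℝ) (t : ℝ)
    (x : EuclideanSpace ℝ (Fin d)) : Set (EuclideanSpace ℝ (Fin d)) :=
  {p | ∀ y, G p + ‖x - p‖ ^ 2 / (2 * t) ≤ G y + ‖x - y‖ ^ 2 / (2 * t)}

/-- the proximal map is coercive: for every `C > 0` there is `R > 0` such that
`‖x‖ ≥ R` and `p ∈ prox_{tG}(x)` imply `‖p‖ ≥ C`. -/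
theorem prox_coercive
    (G : EuclideanSpace ℝ (Fin d) → ℝ) (hG0 : ∀ x, 0 ≤ G x) (hloc : LocBdd G)
    (ρG : ℝ) (hρ : 0 < ρG)
    (hwc : ConvexOn ℝ Set.univ (fun y => G y + ρG / 2 * ‖y‖ ^ 2))
    (t : ℝ) (ht : 0 < t) :
    ∀ C > 0, ∃ R > 0, ∀ x : EuclideanSpace ℝ (Fin d), R ≤ ‖x‖ →
      ∀ p ∈ proxSet G t x, C ≤ ‖p‖ := by
  intro C hC
  have hbd : BddAbove (G '' Metric.closedBall 0 (C + 1)) := by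
    refine (isCompact_closedBall (0 : EuclideanSpace ℝ (Fin d)) (C + 1)).induction_on
      (p := fun s => BddAbove (G '' s)) ?_ ?_ ?_ ?_
    · simp
    · intro s u hsu hu
      exact hu.mono (Set.image_mono hsu)
    · intro s u hs hu
      rw [Set.image_union]
      exact hs.union hu
    · intro x _
      obtain ⟨U, hU, hb⟩ := hloc x
      exact ⟨U, mem_nhdsWithin_of_mem_nhds hU, hb⟩
  obtain ⟨M, hM⟩ := hbd
  refine ⟨C + t * |M| + 2, by positivity, ?_⟩
  intro x hx p hp
  by_contra hlt
  have hpC : ‖p‖ < C := not_le.mp hlt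
  have htM : 0 ≤ t * |M| := by positivity
  have ha : t * |M| + 2 < ‖x - p‖ := by
    have := norm_sub_norm_le x p
    linarith
  have ha0 : 0 < ‖x - p‖ := by linarith
  obtain ⟨a, hadef⟩ : ∃ a, a = ‖x - p‖ := ⟨_, rfl⟩
  rw [← hadef] at ha ha0
  have h1 := hp (p + a⁻¹ • (x - p))
  have hn : ‖a⁻¹ • (x - p)‖ = 1 := by
    rw [norm_smul, ← hadef, Real.norm_of_nonneg (by positivity)]
    field_simp
  have hy : G (p + a⁻¹ • (x - p)) ≤ M := by
    apply hM
    refine ⟨_, ?_, rfl⟩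
    rw [mem_closedBall_zero_iff]
    have := norm_add_le p (a⁻¹ • (x - p))
    linarith
  have hxy : ‖x - (p + a⁻¹ • (x - p))‖ = a - 1 := by
    have e : x - (p + a⁻¹ • (x - p)) = (1 - a⁻¹) • (x - p) := by
      rw [sub_smul, one_smul]; abel
    have hi : a⁻¹ ≤ 1 := inv_le_one_of_one_le₀ (by linarith)
    rw [e, norm_smul, ← hadef, Real.norm_of_nonneg (by linarith)]
    field_simp
  rw [hxy, ← hadef] at h1
  have h2 : a ^ 2 / (2 * t) ≤ |M| + (a - 1) ^ 2 / (2 * t) := by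
    have := hG0 p
    have := le_abs_self M
    linarith
  have h3 : a ^ 2 ≤ |M| * (2 * t) + (a - 1) ^ 2 := by
    have := mul_le_mul_of_nonneg_right h2 (by positivity : 0 ≤ 2 * t)
    field_simp at this
    linarith
  nlinarith
end
end

section
/- Let G : ℝ^d → [0,∞) be locally bounded, weakly convex with modulus ρ_G > 0, and convex outside the ball B_M(0) for some M > 0. Then for every t > 0 there exists R > 0 such that on {x : ‖x‖ ≥ R} the proximal map prox_{tG} is single-valued, the Moreau envelope M_G^t is differentiable with ∇M_G^t(x) = (x − prox_{tG}(x))/t, and for all x, y with ‖x‖, ‖y‖ ≥ R one has ‖prox_{tG}(x) − prox_{tG}(y)‖ ≤ ‖x−y‖ and ‖∇M_G^t(x) − ∇M_G^t(y)‖ ≤ (1/t)‖x−y‖. -/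
noncomputable section

variable {d : ℕ}

/-- `G` is convex outside the ball `B_M(0)`. -/
def ConvexOutside (G : EuclideanSpace ℝ (Fin d) → ℝ) (M : ℝ) : Prop :=
  ∀ x y : EuclideanSpace ℝ (Fin d), M ≤ ‖x‖ → M ≤ ‖y‖ →
    ∀ lam ∈ Set.Icc (0 : ℝ) 1,
      G (lam • x + (1 - lam) • y) ≤ lam * G x + (1 - lam) * G y


lemma aux_cont (G : EuclideanSpace ℝ (Fin d) → ℝ) (ρG : ℝ)
    (hwc : ConvexOn ℝ Set.univ (fun y => G y + ρG / 2 * ‖y‖ ^ 2)) : Continuous G := by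
  have h1 : Continuous (fun y => G y + ρG / 2 * ‖y‖ ^ 2) := by
    have := hwc.continuousOn isOpen_univ
    exact continuousOn_univ.1 this
  have h2 : Continuous (fun y : EuclideanSpace ℝ (Fin d) => ρG / 2 * ‖y‖ ^ 2) := by fun_prop
  have h3 := h1.sub h2
  exact h3.congr (fun y => by simp)

lemma aux_exists (G : EuclideanSpace ℝ (Fin d) → ℝ) (hG0 : ∀ x, 0 ≤ G x) (hc : Continuous G)
    (t : ℝ) (ht : 0 < t) (x : EuclideanSpace ℝ (Fin d)) : ∃ p, p ∈ proxSet G t x := by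
  have hf : Continuous (fun y => G y + ‖x - y‖ ^ 2 / (2 * t)) := by fun_prop
  obtain ⟨p, -, hp⟩ := (isCompact_closedBall x (2 * t * G x + 1)).exists_isMinOn
    ⟨x, Metric.mem_closedBall_self (by have := hG0 x; positivity)⟩ hf.continuousOn
  refine ⟨p, fun y => ?_⟩
  by_cases hy : y ∈ Metric.closedBall x (2 * t * G x + 1)
  · exact hp hy
  · have h0 := hG0 x
    have h1 : G p + ‖x - p‖ ^ 2 / (2 * t) ≤ G x + ‖x - x‖ ^ 2 / (2 * t) :=
      hp (Metric.mem_closedBall_self (by positivity))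
    have h2 : 2 * t * G x + 1 < ‖x - y‖ := by
      rw [Metric.mem_closedBall, not_le, dist_comm, dist_eq_norm] at hy
      exact hy
    have h4 : 0 ≤ 2 * t * G x := by positivity
    have h3 : G x ≤ ‖x - y‖ ^ 2 / (2 * t) := by
      rw [le_div_iff₀ (by positivity)]
      nlinarith
    have := hG0 y
    simp at h1
    linarith

lemma aux_first (G : EuclideanSpace ℝ (Fin d) → ℝ) (M : ℝ) (hconv : ConvexOutside G M)
    (t : ℝ) (ht : 0 < t) (x p q : EuclideanSpace ℝ (Fin d)) (hp : p ∈ proxSet G t x)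
    (hpM : M ≤ ‖p‖) (hqM : M ≤ ‖q‖) : inner ℝ (x - p) (q - p) ≤ t * (G q - G p) := by
  have key : ∀ l : ℝ, 0 < l → l ≤ 1 →
      inner ℝ (x - p) (q - p) ≤ t * (G q - G p) + l * (‖q - p‖ ^ 2 / 2) := by
    intro l hl hl1
    have h1 := hp (l • q + (1 - l) • p)
    have h2 := hconv q p hqM hpM l ⟨hl.le, hl1⟩
    have h3 : x - (l • q + (1 - l) • p) = (x - p) - l • (q - p) := by module
    rw [h3, norm_sub_sq_real (x - p) (l • (q - p)), inner_smul_right, norm_smul, Real.norm_eq_abs, mul_pow, sq_abs] at h1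
    have h4 : G p + ‖x - p‖ ^ 2 / (2 * t) ≤ l * G q + (1 - l) * G p +
        (‖x - p‖ ^ 2 - 2 * (l * inner ℝ (x - p) (q - p)) + l ^ 2 * ‖q - p‖ ^ 2) / (2 * t) := by
      linarith
    have h5 := mul_le_mul_of_nonneg_left h4 (by positivity : 0 ≤ 2 * t)
    field_simp at h5
    have h6 : l * (2 * inner ℝ (x - p) (q - p)) ≤
        l * (2 * (t * (G q - G p) + l * (‖q - p‖ ^ 2 / 2))) := by nlinarith
    have := le_of_mul_le_mul_left h6 hl
    linarith
  apply le_of_forall_pos_le_add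
  intro ε hε
  have hpos : 0 < ‖q - p‖ ^ 2 / 2 + 1 := by positivity
  have hm : 0 < min 1 (ε / (‖q - p‖ ^ 2 / 2 + 1)) := by positivity
  have h := key _ hm (min_le_left _ _)
  have h2 : min 1 (ε / (‖q - p‖ ^ 2 / 2 + 1)) * (‖q - p‖ ^ 2 / 2 + 1) ≤ ε := by
    rw [← le_div_iff₀ hpos]; exact min_le_right _ _
  nlinarith

lemma aux_far (G : EuclideanSpace ℝ (Fin d) → ℝ) (hG0 : ∀ x, 0 ≤ G x) (hc : Continuous G)
    (M : ℝ) (hM : 0 < M) (t : ℝ) (ht : 0 < t) : ∃ R > 0,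
    ∀ x : EuclideanSpace ℝ (Fin d), R ≤ ‖x‖ → ∀ p ∈ proxSet G t x, M ≤ ‖p‖ := by
  obtain ⟨C, hC⟩ := (isCompact_closedBall (0 : EuclideanSpace ℝ (Fin d)) (M + 1)).bddAbove_image
    hc.continuousOn
  have hC' : ∀ y : EuclideanSpace ℝ (Fin d), ‖y‖ ≤ M + 1 → G y ≤ C := fun y hy =>
    hC ⟨y, by simpa using hy, rfl⟩
  have hC0 : 0 ≤ C := (hG0 0).trans (hC' 0 (by simp; linarith))
  refine ⟨M + t * C + 2, by positivity, fun x hx p hp => ?_⟩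
  by_contra hlt
  push Not at hlt
  have hL : t * C + 2 ≤ ‖x - p‖ := by
    have := norm_sub_norm_le x p
    linarith
  have hL0 : 0 < ‖x - p‖ := by have : 0 ≤ t * C := by positivity
                               linarith
  set L := ‖x - p‖ with hLdef
  have h1 := hp (p + L⁻¹ • (x - p))
  have hn : ‖L⁻¹ • (x - p)‖ = 1 := by
    rw [norm_smul, norm_inv, Real.norm_eq_abs, abs_of_pos hL0, ← hLdef]
    field_simp
  have h2 := hC' (p + L⁻¹ • (x - p)) ((norm_add_le _ _).trans (by rw [hn]; linarith))
  have h3 : x - (p + L⁻¹ • (x - p)) = (1 - L⁻¹) • (x - p) := by module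
  have h4 : ‖x - (p + L⁻¹ • (x - p))‖ ^ 2 = (L - 1) ^ 2 := by
    rw [h3, norm_smul, mul_pow, Real.norm_eq_abs, sq_abs, ← hLdef]
    field_simp
  rw [h4, ← hLdef] at h1
  have h0 := hG0 p
  have h5 : L ^ 2 / (2 * t) ≤ C + (L - 1) ^ 2 / (2 * t) := by linarith
  have h6 := mul_le_mul_of_nonneg_left h5 (by positivity : 0 ≤ 2 * t)
  field_simp at h6
  nlinarith

lemma aux_firm {p q x y : EuclideanSpace ℝ (Fin d)} 
    (h : 0 ≤ inner ℝ ((x - p) - (y - q)) (p - q)) :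
    ‖p - q‖ ≤ ‖x - y‖ ∧ ‖(x - p) - (y - q)‖ ≤ ‖x - y‖ := by
  have e : x - y = ((x - p) - (y - q)) + (p - q) := by abel
  have h1 : ‖x - y‖ ^ 2 = ‖(x - p) - (y - q)‖ ^ 2 +
      2 * inner ℝ ((x - p) - (y - q)) (p - q) + ‖p - q‖ ^ 2 := by
    rw [e, norm_add_sq_real]
  constructor
  · refine (sq_le_sq₀ (norm_nonneg _) (norm_nonneg _)).1 ?_
    nlinarith [sq_nonneg ‖(x - p) - (y - q)‖]
  · refine (sq_le_sq₀ (norm_nonneg _) (norm_nonneg _)).1 ?_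
    nlinarith [sq_nonneg ‖p - q‖]

lemma aux_moreau_eq (G : EuclideanSpace ℝ (Fin d) → ℝ) (hG0 : ∀ x, 0 ≤ G x)
    (t : ℝ) (ht : 0 < t) (x p : EuclideanSpace ℝ (Fin d)) (hp : p ∈ proxSet G t x) :
    moreau G t x = G p + ‖x - p‖ ^ 2 / (2 * t) := by
  rw [moreau, if_neg ht.ne']
  apply le_antisymm
  · exact ciInf_le ⟨0, by rintro _ ⟨y, rfl⟩; have := hG0 y; positivity⟩ p
  · exact le_ciInf hp

lemma aux_upper (G : EuclideanSpace ℝ (Fin d) → ℝ) (hG0 : ∀ x, 0 ≤ G x)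
    (t : ℝ) (ht : 0 < t) (x p y q : EuclideanSpace ℝ (Fin d)) (hp : p ∈ proxSet G t x)
    (hq : q ∈ proxSet G t y) :
    t * (moreau G t y - moreau G t x) ≤ inner ℝ (x - p) (y - x) + ‖y - x‖ ^ 2 / 2 := by
  rw [aux_moreau_eq G hG0 t ht x p hp, aux_moreau_eq G hG0 t ht y q hq]
  have h1 := hq p
  have e : y - p = (x - p) + (y - x) := by abel
  rw [e, norm_add_sq_real] at h1
  have h5 := mul_le_mul_of_nonneg_left h1 ht.le
  have h6 : t * ((‖x - p‖ ^ 2 + 2 * inner ℝ (x - p) (y - x) + ‖y - x‖ ^ 2) / (2 * t)) =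
     t * (‖x - p‖ ^ 2 / (2 * t)) + inner ℝ (x - p) (y - x) + ‖y - x‖ ^ 2 / 2 := by
    field_simp
  rw [mul_add t (G p), h6] at h5
  linarith

/-- for every `t > 0` there is `R > 0` such that outside `B_R(0)` the proximal
map is single-valued, the Moreau envelope is differentiable with gradient
`(x − prox_{tG}(x))/t`, and both `prox_{tG}` and `∇M_G^t` satisfy the stated Lipschitz
estimates with constants `1` and `1/t`. -/
theorem prox_moreau_outside_ball
    (G : EuclideanSpace ℝ (Fin d) → ℝ) (hG0 : ∀ x, 0 ≤ G x) (hloc : LocBdd G)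
    (ρG : ℝ) (hρ : 0 < ρG)
    (hwc : ConvexOn ℝ Set.univ (fun y => G y + ρG / 2 * ‖y‖ ^ 2))
    (M : ℝ) (hM : 0 < M) (hconv : ConvexOutside G M)
    (t : ℝ) (ht : 0 < t) :
    ∃ R > 0,
      (∀ x : EuclideanSpace ℝ (Fin d), R ≤ ‖x‖ → ∃! p, p ∈ proxSet G t x) ∧
      (∀ x : EuclideanSpace ℝ (Fin d), R ≤ ‖x‖ → ∀ p ∈ proxSet G t x,
        HasGradientAt (moreau G t) ((1 / t) • (x - p)) x) ∧
      (∀ x y : EuclideanSpace ℝ (Fin d), R ≤ ‖x‖ → R ≤ ‖y‖ →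
        ∀ p ∈ proxSet G t x, ∀ q ∈ proxSet G t y,
          ‖p - q‖ ≤ ‖x - y‖ ∧
          ‖(1 / t) • (x - p) - (1 / t) • (y - q)‖ ≤ (1 / t) * ‖x - y‖) := by
  have hc := aux_cont G ρG hwc
  obtain ⟨R, hR, hfar⟩ := aux_far G hG0 hc M hM t ht
  have firm : ∀ x y : EuclideanSpace ℝ (Fin d), R ≤ ‖x‖ → R ≤ ‖y‖ →
        ∀ p ∈ proxSet G t x, ∀ q ∈ proxSet G t y,
          ‖p - q‖ ≤ ‖x - y‖ ∧ ‖(x - p) - (y - q)‖ ≤ ‖x - y‖ := by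
    intro x y hx hy p hp q hq
    have a := aux_first G M hconv t ht x p q hp (hfar x hx p hp) (hfar y hy q hq)
    have b := aux_first G M hconv t ht y q p hq (hfar y hy q hq) (hfar x hx p hp)
    apply aux_firm
    have e : inner ℝ (x - p) (q - p) = - inner ℝ (x - p) (p - q) := by
      rw [← inner_neg_right, neg_sub]
    rw [inner_sub_left]
    linarith
  refine ⟨R + 1, by positivity, ?_, ?_, ?_⟩
  · intro x hx
    obtain ⟨p, hp⟩ := aux_exists G hG0 hc t ht x
    refine ⟨p, hp, fun q hq => ?_⟩
    have := (firm x x (by linarith) (by linarith) q hq p hp).1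
    rw [sub_self, norm_zero] at this
    exact sub_eq_zero.1 (norm_le_zero_iff.1 this)
  · intro x hx p hp
    rw [hasGradientAt_iff_isLittleO]
    have hO : (fun y => moreau G t y - moreau G t x - inner ℝ ((1 / t) • (x - p)) (y - x))
        =O[nhds x] fun y => ‖y - x‖ ^ 2 := by
      apply Asymptotics.IsBigO.of_bound (3 / (2 * t))
      filter_upwards [Metric.ball_mem_nhds x one_pos] with y hy
      rw [Metric.mem_ball, dist_eq_norm] at hy
      have hy' : R ≤ ‖y‖ := by
        have := norm_sub_norm_le x y
        rw [norm_sub_rev] at this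
        linarith
      obtain ⟨q, hq⟩ := aux_exists G hG0 hc t ht y
      have u1 := aux_upper G hG0 t ht x p y q hp hq
      have u2 := aux_upper G hG0 t ht y q x p hq hp
      have f := (firm x y (by linarith) hy' p hp q hq).2
      have cs := (abs_le.1 (abs_real_inner_le_norm ((x - p) - (y - q)) (y - x))).2
      rw [norm_sub_rev x y] at f u2
      have f2 := mul_le_mul_of_nonneg_right f (norm_nonneg (y - x))
      have e : inner ℝ (y - q) (x - y) = - inner ℝ (y - q) (y - x) := by
        rw [← inner_neg_right, neg_sub]
      rw [inner_sub_left] at cs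
      rw [inner_smul_left, Real.norm_eq_abs, Real.norm_eq_abs, abs_of_nonneg (sq_nonneg ‖y - x‖)]
      have e2 : moreau G t y - moreau G t x -
          (starRingEnd ℝ) (1 / t) * inner ℝ (x - p) (y - x) =
          (t * (moreau G t y - moreau G t x) - inner ℝ (x - p) (y - x)) / t := by
        simp only [conj_trivial]
        field_simp
      have e3 : 3 / (2 * t) * ‖y - x‖ ^ 2 = (3 / 2 * ‖y - x‖ ^ 2) / t := by field_simp
      rw [e2, e3, abs_div, abs_of_pos ht]
      apply div_le_div_of_nonneg_right _ ht.le
      rw [abs_le]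
      constructor <;> nlinarith [sq_nonneg ‖y - x‖]
    refine hO.trans_isLittleO ?_
    have := (Asymptotics.isLittleO_pow_sub_sub x (m := 2) one_lt_two)
    simpa using this
  · intro x y hx hy p hp q hq
    have f := firm x y (by linarith) (by linarith) p hp q hq
    refine ⟨f.1, ?_⟩
    rw [← smul_sub, norm_smul, Real.norm_eq_abs, abs_of_pos (by positivity)]
    exact mul_le_mul_of_nonneg_left f.2 (by positivity)
end
end

section
/- Let G : ℝ^d → [0,∞) be locally bounded, weakly convex with modulus ρ_G > 0, and convex outside the ball B_M(0) for some M > 0. Then for every t > 0 the Moreau envelope M_G^t is convex outside a ball: there exists R > 0 such that for all x, y with ‖x‖, ‖y‖ ≥ R and all λ ∈ [0,1], M_G^t(λx + (1−λ)y) ≤ λ M_G^t(x) + (1−λ) M_G^t(y). -/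
noncomputable section

variable {d : ℕ}

/-- Locally bounded functions are bounded above on closed balls. -/
lemma LocBdd.bound_closedBall {G : EuclideanSpace ℝ (Fin d) → ℝ} (hloc : LocBdd G) (K : ℝ) :
    ∃ C : ℝ, 0 ≤ C ∧ ∀ y, ‖y‖ ≤ K → G y ≤ C := by
  have hc : IsCompact (Metric.closedBall (0 : EuclideanSpace ℝ (Fin d)) K) :=
    isCompact_closedBall _ _
  have hb : BddAbove (G '' Metric.closedBall (0 : EuclideanSpace ℝ (Fin d)) K) := by
    refine hc.induction_on (p := fun s => BddAbove (G '' s)) (by simp) ?_ ?_ ?_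
    · intro s t hst h
      exact h.mono (Set.image_mono hst)
    · intro s t hs h
      rw [Set.image_union]
      exact hs.union h
    · intro x _
      obtain ⟨U, hU, hB⟩ := hloc x
      exact ⟨U, mem_nhdsWithin_of_mem_nhds hU, hB⟩
  obtain ⟨C, hC⟩ := hb
  refine ⟨max C 0, le_max_right _ _, fun y hy => le_max_of_le_left (hC ⟨y, ?_, rfl⟩)⟩
  simpa using hy

/-- Far from the origin, points inside the ball may be replaced by points outside. -/
lemma exists_outside_le {G : EuclideanSpace ℝ (Fin d) → ℝ} (hG0 : ∀ x, 0 ≤ G x)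
    {M C t : ℝ} (hM : 0 < M) (ht : 0 < t) (hC0 : 0 ≤ C) (hC : ∀ y, ‖y‖ ≤ M + 1 → G y ≤ C)
    (x u : EuclideanSpace ℝ (Fin d)) (hx : M + 1 + t * C ≤ ‖x‖) :
    ∃ v, M ≤ ‖v‖ ∧ G v + ‖x - v‖ ^ 2 / (2 * t) ≤ G u + ‖x - u‖ ^ 2 / (2 * t) := by
  by_cases hu : M ≤ ‖u‖
  · exact ⟨u, hu, le_rfl⟩
  push Not at hu
  have htC : 0 ≤ t * C := by positivity
  have hxp : 0 < ‖x‖ := by linarith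
  have hv : ‖((M + 1) / ‖x‖) • x‖ = M + 1 := by
    rw [norm_smul, Real.norm_eq_abs, abs_of_pos (by positivity)]
    field_simp
  have hxv : ‖x - ((M + 1) / ‖x‖) • x‖ = ‖x‖ - (M + 1) := by
    have : x - ((M + 1) / ‖x‖) • x = (1 - (M + 1) / ‖x‖) • x := by rw [sub_smul, one_smul]
    rw [this, norm_smul, Real.norm_eq_abs, abs_of_nonneg]
    · field_simp
    · rw [sub_nonneg, div_le_one hxp]; linarith
  refine ⟨((M + 1) / ‖x‖) • x, by rw [hv]; linarith, ?_⟩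
  have h1 := hC _ hv.le
  have h2 : ‖x‖ - M ≤ ‖x - u‖ := by have := norm_sub_norm_le x u; linarith
  have h3 : (‖x‖ - M) ^ 2 ≤ ‖x - u‖ ^ 2 := by
    apply pow_le_pow_left₀ _ h2; linarith
  rw [hxv]
  have h4 : C + (‖x‖ - (M + 1)) ^ 2 / (2 * t) ≤ (‖x - u‖) ^ 2 / (2 * t) := by
    rw [← sub_nonneg]
    have : ‖x - u‖ ^ 2 / (2 * t) - (C + (‖x‖ - (M + 1)) ^ 2 / (2 * t))
      = (‖x - u‖ ^ 2 - 2 * (t * C) - (‖x‖ - (M + 1)) ^ 2) / (2 * t) := by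
      field_simp; ring
    rw [this]
    apply div_nonneg _ (by positivity)
    nlinarith
  linarith [hG0 u]

/-- the Moreau envelope of `G` is convex outside a ball. -/
theorem moreau_convex_outside_ball
    (G : EuclideanSpace ℝ (Fin d) → ℝ) (hG0 : ∀ x, 0 ≤ G x) (hloc : LocBdd G)
    (ρG : ℝ) (hρ : 0 < ρG)
    (hwc : ConvexOn ℝ Set.univ (fun y => G y + ρG / 2 * ‖y‖ ^ 2))
    (M : ℝ) (hM : 0 < M) (hconv : ConvexOutside G M)
    (t : ℝ) (ht : 0 < t) :
    ∃ R > 0, ConvexOutside (moreau G t) R := by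
  obtain ⟨C, hC0, hC⟩ := hloc.bound_closedBall (M + 1)
  refine ⟨M + 1 + t * C, by positivity, ?_⟩
  intro x y hx hy lam hlam
  obtain ⟨hl0, hl1⟩ := hlam
  have hbdd : ∀ z, BddBelow (Set.range fun y : EuclideanSpace ℝ (Fin d) =>
      G y + ‖z - y‖ ^ 2 / (2 * t)) := by
    intro z
    refine ⟨0, ?_⟩
    rintro _ ⟨w, rfl⟩
    have := hG0 w
    positivity
  have hnear : ∀ z, M + 1 + t * C ≤ ‖z‖ → ∀ ε > 0, ∃ v, M ≤ ‖v‖ ∧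
      G v + ‖z - v‖ ^ 2 / (2 * t) ≤
        (⨅ y : EuclideanSpace ℝ (Fin d), (G y + ‖z - y‖ ^ 2 / (2 * t))) + ε := by
    intro z hz ε hε
    obtain ⟨u, hu⟩ := exists_lt_of_ciInf_lt (lt_add_of_pos_right
      (⨅ y : EuclideanSpace ℝ (Fin d), (G y + ‖z - y‖ ^ 2 / (2 * t))) hε)
    obtain ⟨v, hv, hvu⟩ := exists_outside_le hG0 hM ht hC0 hC z u hz
    exact ⟨v, hv, hvu.trans hu.le⟩
  simp only [moreau, if_neg ht.ne']
  refine le_of_forall_pos_le_add fun ε hε => ?_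
  obtain ⟨u, hu, hu'⟩ := hnear x hx ε hε
  obtain ⟨v, hv, hv'⟩ := hnear y hy ε hε
  refine (ciInf_le (hbdd _) (lam • u + (1 - lam) • v)).trans ?_
  have hg := hconv u v hu hv lam ⟨hl0, hl1⟩
  have hl1' : 0 ≤ 1 - lam := by linarith
  have hn : ‖lam • x + (1 - lam) • y - (lam • u + (1 - lam) • v)‖ ^ 2
      ≤ lam * ‖x - u‖ ^ 2 + (1 - lam) * ‖y - v‖ ^ 2 := by
    have e : lam • x + (1 - lam) • y - (lam • u + (1 - lam) • v)
        = lam • (x - u) + (1 - lam) • (y - v) := by module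
    have h1 : ‖lam • (x - u) + (1 - lam) • (y - v)‖ ≤ lam * ‖x - u‖ + (1 - lam) * ‖y - v‖ := by
      refine (norm_add_le _ _).trans ?_
      rw [norm_smul, norm_smul, Real.norm_of_nonneg hl0, Real.norm_of_nonneg hl1']
    rw [e]
    refine (pow_le_pow_left₀ (norm_nonneg _) h1 2).trans ?_
    nlinarith [mul_nonneg (mul_nonneg hl0 hl1') (sq_nonneg (‖x - u‖ - ‖y - v‖))]
  have hn' : ‖lam • x + (1 - lam) • y - (lam • u + (1 - lam) • v)‖ ^ 2 / (2 * t)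
      ≤ lam * (‖x - u‖ ^ 2 / (2 * t)) + (1 - lam) * (‖y - v‖ ^ 2 / (2 * t)) := by
    refine (div_le_div_of_nonneg_right hn (by positivity)).trans (le_of_eq ?_)
    ring
  have a1 := mul_le_mul_of_nonneg_left hu' hl0
  have a2 := mul_le_mul_of_nonneg_left hv' hl1'
  linarith
end
end

section
/- Let G : ℝ^d → [0,∞) be locally bounded, weakly convex with modulus ρ_G > 0, convex outside a ball B_M(0), and superexponential with minimizer x*, supex radius M_ρ and supex modulus ρ > 0. Then for every t > 0 there exists M'_ρ > 0 such that for every x with ‖x − x*‖ ≥ M'_ρ the proximal map is single-valued at x and ⟨(x − prox_{tG}(x))/t, x − x*⟩ ≥ min(ρ/4, 1/(2t)) ‖x − x*‖²; that is, the Moreau envelope preserves the superexponential property. -/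
noncomputable section

open scoped RealInnerProductSpace

variable {d : ℕ}

/-- Regular (Fréchet) subdifferential: `v ∈ ∂G(x)` iff
`liminf_{y→x, y≠x} (G(y) − G(x) − ⟨v, y−x⟩)/‖y−x‖ ≥ 0`. -/
def regSubdiff (G : EuclideanSpace ℝ (Fin d) → ℝ) (x : EuclideanSpace ℝ (Fin d)) :
    Set (EuclideanSpace ℝ (Fin d)) :=
  {v | ∀ ε > 0, ∀ᶠ y in nhdsWithin x {x}ᶜ,
    -(ε * ‖y - x‖) ≤ G y - G x - ⟪v, y - x⟫}

/-- the Moreau envelope preserves the superexponential property: for every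
`t > 0` there is `M'_ρ > 0` such that for `‖x − x*‖ ≥ M'_ρ` the prox is single-valued and
`⟨(x − prox_{tG}(x))/t, x − x*⟩ ≥ min(ρ/4, 1/(2t)) ‖x − x*‖²`. -/
theorem moreau_superexponential
    (G : EuclideanSpace ℝ (Fin d) → ℝ) (hG0 : ∀ x, 0 ≤ G x) (hloc : LocBdd G)
    (ρG : ℝ) (hρG : 0 < ρG)
    (hwc : ConvexOn ℝ Set.univ (fun y => G y + ρG / 2 * ‖y‖ ^ 2))
    (M : ℝ) (hM : 0 < M) (hconv : ConvexOutside G M)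
    (xstar : EuclideanSpace ℝ (Fin d)) (hmin : ∀ y, G xstar ≤ G y)
    (ρ Mρ : ℝ) (hρ : 0 < ρ) (hMρ : 0 < Mρ)
    (hsupex : ∀ x : EuclideanSpace ℝ (Fin d), Mρ ≤ ‖x - xstar‖ →
      ∀ v ∈ regSubdiff G x, ρ * ‖x - xstar‖ ^ 2 ≤ ⟪v, x - xstar⟫)
    (t : ℝ) (ht : 0 < t) :
    ∃ Mρ' > 0, ∀ x : EuclideanSpace ℝ (Fin d), Mρ' ≤ ‖x - xstar‖ →
      (∃! p, p ∈ proxSet G t x) ∧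
      ∀ p ∈ proxSet G t x,
        min (ρ / 4) (1 / (2 * t)) * ‖x - xstar‖ ^ 2 ≤ ⟪(1 / t) • (x - p), x - xstar⟫ := by
  have hcont : Continuous G := by
    have h1 : Continuous (fun y => G y + ρG / 2 * ‖y‖ ^ 2) := by
      rw [← continuousOn_univ]
      exact hwc.continuousOn isOpen_univ
    have h2 : Continuous (fun y : EuclideanSpace ℝ (Fin d) => ρG / 2 * ‖y‖ ^ 2) := by fun_prop
    have h3 := h1.sub h2
    have h4 : ((fun y => G y + ρG / 2 * ‖y‖ ^ 2) -
        fun y : EuclideanSpace ℝ (Fin d) => ρG / 2 * ‖y‖ ^ 2) = G := by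
      funext y
      simp
    rwa [h4] at h3
  -- existence of the minimizer
  have hex : ∀ x, ∃ p, p ∈ proxSet G t x := by
    intro x
    have hc : Continuous (fun y => G y + ‖x - y‖ ^ 2 / (2 * t)) := by fun_prop
    obtain ⟨b, hb⟩ : ∃ b : ℝ, b = G x := ⟨_, rfl⟩
    have hr : 0 < 2 * t * b + 1 := by
      have := hG0 x
      rw [hb]; positivity
    obtain ⟨p, hp, hpm⟩ := (isCompact_closedBall x (2 * t * b + 1)).exists_isMinOn
      ⟨x, Metric.mem_closedBall_self hr.le⟩ hc.continuousOn
    refine ⟨p, fun y => ?_⟩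
    by_cases hy : y ∈ Metric.closedBall x (2 * t * b + 1)
    · exact hpm hy
    · have h1 : G p + ‖x - p‖ ^ 2 / (2 * t) ≤ G x + ‖x - x‖ ^ 2 / (2 * t) :=
        hpm (Metric.mem_closedBall_self hr.le)
      simp only [sub_self, norm_zero] at h1
      have h2 : 2 * t * b + 1 < ‖x - y‖ := by
        rw [Metric.mem_closedBall, dist_comm, dist_eq_norm] at hy
        exact not_le.mp hy
      have hb0 : 0 ≤ 2 * t * b := by
        have := hG0 x
        rw [hb]; positivity
      have h3 : b ≤ ‖x - y‖ ^ 2 / (2 * t) := by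
        rw [le_div_iff₀ (by positivity)]
        nlinarith
      have h4 := hG0 y
      norm_num at h1
      linarith
  obtain ⟨R, hR⟩ : ∃ R : ℝ, R = max Mρ (M + ‖xstar‖) := ⟨_, rfl⟩
  have hR1 : Mρ ≤ R := hR ▸ le_max_left _ _
  have hR2 : M + ‖xstar‖ ≤ R := hR ▸ le_max_right _ _
  obtain ⟨C, hC⟩ := (isCompact_closedBall xstar (R + 1)).bddAbove_image hcont.continuousOn
  have hCb : ∀ y, ‖y - xstar‖ ≤ R + 1 → G y ≤ C := by
    intro y hy
    exact hC ⟨y, by rwa [Metric.mem_closedBall, dist_eq_norm], rfl⟩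
  have hC0 : 0 ≤ C := (hG0 xstar).trans (hCb xstar (by simp; linarith))
  -- the prox points are far when `x` is far
  have hfar : ∀ x, R + t * C + 1 ≤ ‖x - xstar‖ → ∀ p ∈ proxSet G t x, R ≤ ‖p - xstar‖ := by
    intro x hx p hp
    by_contra hlt
    push Not at hlt
    have htri : ‖x - xstar‖ ≤ ‖x - p‖ + ‖p - xstar‖ := norm_sub_le_norm_sub_add_norm_sub _ _ _
    have htC : 0 ≤ t * C := by positivity
    have hr : 0 < ‖x - p‖ := by linarith
    have h1 := hp (p + (1 / ‖x - p‖) • (x - p))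
    have hn1 : ‖(1 / ‖x - p‖) • (x - p)‖ = 1 := by
      rw [norm_smul, Real.norm_of_nonneg (by positivity)]
      field_simp
    have h2 : G (p + (1 / ‖x - p‖) • (x - p)) ≤ C := by
      apply hCb
      have : p + (1 / ‖x - p‖) • (x - p) - xstar
          = (p - xstar) + (1 / ‖x - p‖) • (x - p) := by abel
      rw [this]
      refine (norm_add_le _ _).trans ?_
      rw [hn1]; linarith
    have h3 : ‖x - (p + (1 / ‖x - p‖) • (x - p))‖ ^ 2 = (‖x - p‖ - 1) ^ 2 := by
      have : x - (p + (1 / ‖x - p‖) • (x - p)) = (1 - 1 / ‖x - p‖) • (x - p) := by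
        rw [sub_smul, one_smul]; abel
      rw [this, norm_smul, mul_pow, Real.norm_eq_abs, sq_abs]
      field_simp
    rw [h3] at h1
    have h4 := hG0 p
    have h5 : ‖x - p‖ ^ 2 / (2 * t) ≤ C + (‖x - p‖ - 1) ^ 2 / (2 * t) := by linarith
    have h6 : ‖x - p‖ ^ 2 ≤ C * (2 * t) + (‖x - p‖ - 1) ^ 2 := by
      have h7 := mul_le_mul_of_nonneg_right h5 (by positivity : (0:ℝ) ≤ 2 * t)
      rwa [add_mul, div_mul_cancel₀ _ (by positivity), div_mul_cancel₀ _ (by positivity)] at h7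
    nlinarith
  refine ⟨R + t * C + 1, by nlinarith [mul_nonneg ht.le hC0], fun x hx => ⟨?_, ?_⟩⟩
  · obtain ⟨p, hp⟩ := hex x
    refine ⟨p, hp, fun q hq => ?_⟩
    have hnM : ∀ z ∈ proxSet G t x, M ≤ ‖z‖ := by
      intro z hz
      have h1 := hfar x hx z hz
      have h2 := norm_sub_le z xstar
      linarith
    have h1 := hconv p q (hnM p hp) (hnM q hq) (1 / 2) (by norm_num)
    have h2 := hp ((1 / 2 : ℝ) • p + (1 - 1 / 2 : ℝ) • q)
    have h3 := hq p
    have h3' := hp q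
    have h4 : ‖x - ((1 / 2 : ℝ) • p + (1 - 1 / 2 : ℝ) • q)‖ ^ 2
        = ‖x - p‖ ^ 2 / 2 + ‖x - q‖ ^ 2 / 2 - ‖q - p‖ ^ 2 / 4 := by
      have e1 : x - ((1 / 2 : ℝ) • p + (1 - 1 / 2 : ℝ) • q)
          = (1 / 2 : ℝ) • ((x - p) + (x - q)) := by module
      have e2 : q - p = (x - p) - (x - q) := by abel
      rw [e1, e2, norm_smul, mul_pow, norm_add_sq_real, norm_sub_sq_real (x - p) (x - q)]
      norm_num
      ring
    rw [h4] at h2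
    have h5 : (‖x - p‖ ^ 2 / 2 + ‖x - q‖ ^ 2 / 2 - ‖q - p‖ ^ 2 / 4) / (2 * t)
        = ‖x - p‖ ^ 2 / (2 * t) / 2 + ‖x - q‖ ^ 2 / (2 * t) / 2
          - ‖q - p‖ ^ 2 / (2 * t) / 4 := by ring
    rw [h5] at h2
    have h6 : ‖q - p‖ ^ 2 / (2 * t) ≤ 0 := by linarith
    have h7 : ‖q - p‖ ^ 2 ≤ 0 := by
      rwa [div_le_iff₀ (by positivity), zero_mul] at h6
    have h8 : ‖q - p‖ = 0 := by nlinarith [norm_nonneg (q - p)]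
    exact sub_eq_zero.mp (norm_eq_zero.mp h8)
  · intro p hp
    obtain ⟨v, hv⟩ : ∃ v, v = (1 / t) • (x - p) := ⟨_, rfl⟩
    have hxv : x - p = t • v := by
      rw [hv, smul_smul, mul_one_div_cancel ht.ne', one_smul]
    have hsub : v ∈ regSubdiff G p := by
      intro ε hε
      have hball : Metric.ball p (2 * t * ε) ∈ nhdsWithin p {p}ᶜ :=
        mem_nhdsWithin_of_mem_nhds (Metric.ball_mem_nhds p (by positivity))
      filter_upwards [hball] with y hy
      rw [Metric.mem_ball, dist_eq_norm] at hy
      have h1 := hp y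
      have e1 : x - y = t • v - (y - p) := by rw [← hxv]; abel
      rw [e1, hxv, norm_sub_sq_real, real_inner_smul_left] at h1
      have h2 : (‖t • v‖ ^ 2 - 2 * (t * ⟪v, y - p⟫) + ‖y - p‖ ^ 2) / (2 * t)
          = ‖t • v‖ ^ 2 / (2 * t) - ⟪v, y - p⟫ + ‖y - p‖ ^ 2 / (2 * t) := by
        field_simp
      rw [h2] at h1
      have h3 : ‖y - p‖ ^ 2 / (2 * t) ≤ ε * ‖y - p‖ := by
        rw [div_le_iff₀ (by positivity)]
        nlinarith [norm_nonneg (y - p)]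
      linarith
    have hmain := hsupex p (hR1.trans (hfar x hx p hp)) v hsub
    rw [← hv]
    have e2 : x - xstar = (p - xstar) + t • v := by rw [← hxv]; abel
    obtain ⟨u, hu⟩ : ∃ u, u = p - xstar := ⟨_, rfl⟩
    rw [← hu] at e2 hmain
    rw [e2, inner_add_right, real_inner_smul_right, real_inner_self_eq_norm_sq]
    obtain ⟨c, hc⟩ : ∃ c, c = min (ρ / 4) (1 / (2 * t)) := ⟨_, rfl⟩
    rw [← hc]
    have hc1 : c ≤ ρ / 4 := hc ▸ min_le_left _ _
    have hc2 : c * (2 * t) ≤ 1 := by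
      have : c ≤ 1 / (2 * t) := hc ▸ min_le_right _ _
      rwa [le_div_iff₀ (by positivity)] at this
    have hc0 : 0 < c := by rw [hc]; positivity
    have h1 : ‖u + t • v‖ ^ 2 ≤ 2 * ‖u‖ ^ 2 + 2 * (t ^ 2 * ‖v‖ ^ 2) := by
      have e3 := parallelogram_law_with_norm ℝ u (t • v)
      have e4 : ‖t • v‖ ^ 2 = t ^ 2 * ‖v‖ ^ 2 := by
        rw [norm_smul, mul_pow, Real.norm_eq_abs, sq_abs]
      nlinarith [sq_nonneg ‖u - t • v‖]
    have h2 : c * ‖u + t • v‖ ^ 2 ≤ c * (2 * ‖u‖ ^ 2 + 2 * (t ^ 2 * ‖v‖ ^ 2)) :=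
      mul_le_mul_of_nonneg_left h1 hc0.le
    have h3 : c * ‖u‖ ^ 2 ≤ ρ / 4 * ‖u‖ ^ 2 :=
      mul_le_mul_of_nonneg_right hc1 (sq_nonneg _)
    have h4 : c * (2 * t) * (t * ‖v‖ ^ 2) ≤ 1 * (t * ‖v‖ ^ 2) :=
      mul_le_mul_of_nonneg_right hc2 (by positivity)
    have h5 : 0 ≤ ρ * ‖u‖ ^ 2 := by positivity
    nlinarith
end
end

section
/- Let G : ℝ^d → [0,∞) be locally bounded and weakly convex with modulus ρ_G > 0. Then for every fixed x ∈ ℝ^d the function t ↦ M_G^t(x) is differentiable on (0, 1/ρ_G) with derivative ∂_t M_G^t(x) = −‖x − prox_{tG}(x)‖²/(2t²). -/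
noncomputable section

variable {d : ℕ}

/-- Quadratic growth of the proximal objective around a minimizer. -/
lemma prox_growth
    (G : EuclideanSpace ℝ (Fin d) → ℝ) (ρG : ℝ)
    (hwc : ConvexOn ℝ Set.univ (fun y => G y + ρG / 2 * ‖y‖ ^ 2))
    (x : EuclideanSpace ℝ (Fin d)) (t : ℝ)
    (p : EuclideanSpace ℝ (Fin d)) (hp : p ∈ proxSet G t x) (y : EuclideanSpace ℝ (Fin d)) :
    G p + ‖x - p‖ ^ 2 / (2 * t) + (1 / t - ρG) / 4 * ‖y - p‖ ^ 2
      ≤ G y + ‖x - y‖ ^ 2 / (2 * t) := by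
  have h1 := hwc.2 (Set.mem_univ p) (Set.mem_univ y) (by norm_num : (0:ℝ) ≤ 1/2)
    (by norm_num : (0:ℝ) ≤ 1/2) (by norm_num)
  have h2 := hp ((1/2:ℝ) • p + (1/2:ℝ) • y)
  have e1 : ‖(1/2:ℝ) • p + (1/2:ℝ) • y‖ ^ 2
      = 1/2 * ‖p‖^2 + 1/2 * ‖y‖^2 - 1/4 * ‖y - p‖^2 := by
    rw [norm_add_sq_real, norm_sub_sq_real, norm_smul, norm_smul, inner_smul_left,
      inner_smul_right, real_inner_comm]
    norm_num
    ring
  have e2 : ‖x - ((1/2:ℝ) • p + (1/2:ℝ) • y)‖ ^ 2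
      = 1/2 * ‖x - p‖^2 + 1/2 * ‖x - y‖^2 - 1/4 * ‖y - p‖^2 := by
    have ea : x - ((1/2:ℝ) • p + (1/2:ℝ) • y) = (1/2:ℝ) • (x - p) + (1/2:ℝ) • (x - y) := by
      module
    have eb : y - p = (x - p) - (x - y) := by abel
    rw [ea, eb, norm_add_sq_real, norm_sub_sq_real (x - p), norm_smul, norm_smul,
      inner_smul_left, inner_smul_right]
    norm_num
    ring
  simp only [smul_eq_mul] at h1
  rw [e1] at h1
  rw [e2] at h2
  have e3 : ∀ u : ℝ, u / (2 * t) = u * (1 / t) / 2 := by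
    intro u
    rw [div_mul_eq_div_div, div_eq_mul_one_div (u / 2) t]
    ring
  simp only [e3] at h2 ⊢
  linarith

/-- for fixed `x`, the map `t ↦ M_G^t(x)` is differentiable on `(0, 1/ρ_G)`
with derivative `∂_t M_G^t(x) = −‖x − prox_{tG}(x)‖²/(2t²)`. -/
theorem moreau_time_deriv
    (G : EuclideanSpace ℝ (Fin d) → ℝ) (hG0 : ∀ x, 0 ≤ G x) (hloc : LocBdd G)
    (ρG : ℝ) (hρ : 0 < ρG)
    (hwc : ConvexOn ℝ Set.univ (fun y => G y + ρG / 2 * ‖y‖ ^ 2)) :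
    ∀ x : EuclideanSpace ℝ (Fin d), ∀ t ∈ Set.Ioo (0 : ℝ) (1 / ρG), ∀ p ∈ proxSet G t x,
      HasDerivAt (fun s => moreau G s x) (-(‖x - p‖ ^ 2 / (2 * t ^ 2))) t := by
  intro x t ht p hp
  obtain ⟨ht0, ht1⟩ := ht
  have hc : 0 < (1 / t - ρG) / 4 := by
    have : ρG < 1 / t := by
      rw [lt_div_iff₀ ht0]
      rw [lt_div_iff₀ hρ] at ht1
      linarith
    linarith
  have hgrow := prox_growth G ρG hwc x t p hp
  set c := (1 / t - ρG) / 4 with hcdef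
  have hbdd : ∀ s : ℝ, 0 < s → BddBelow (Set.range fun y => G y + ‖x - y‖ ^ 2 / (2 * s)) := by
    intro s hs
    refine ⟨0, ?_⟩
    rintro _ ⟨y, rfl⟩
    have := hG0 y
    positivity
  have hMt : moreau G t x = G p + ‖x - p‖ ^ 2 / (2 * t) := by
    unfold moreau
    rw [if_neg ht0.ne']
    exact le_antisymm (ciInf_le (hbdd t ht0) p) (le_ciInf hp)
  have hδ : HasDerivAt (fun s : ℝ => 1 / (2 * s) - 1 / (2 * t)) (-(1 / (2 * t ^ 2))) t := by
    have h := ((hasDerivAt_inv ht0.ne').const_mul (1 / 2 : ℝ)).sub_const (1 / (2 * t))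
    have e : (fun s : ℝ => 1 / 2 * s⁻¹ - 1 / (2 * t)) = fun s : ℝ => 1 / (2 * s) - 1 / (2 * t) := by
      funext s
      rw [one_div, one_div, one_div, mul_inv, mul_inv]
    rw [← e]
    refine h.congr_deriv ?_
    rw [one_div, one_div, mul_inv]
    ring
  set δ : ℝ → ℝ := fun s => 1 / (2 * s) - 1 / (2 * t) with hδdef
  have hδt : δ t = 0 := by simp [hδdef]
  have hsmall : ∀ᶠ s in nhds t, |δ s| < c / 2 := by
    have h := hδ.continuousAt.abs
    have h' : (fun s => |δ s|) t < c / 2 := by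
      simp only [hδt, abs_zero]
      linarith
    exact h.eventually_lt continuousAt_const h'
  have hpos : ∀ᶠ s in nhds t, 0 < s := lt_mem_nhds ht0
  have hbig : (fun s => moreau G s x - moreau G t x - ‖x - p‖ ^ 2 * δ s)
      =O[nhds t] (fun s => ‖s - t‖ ^ 2) := by
    have h1 : (fun s => moreau G s x - moreau G t x - ‖x - p‖ ^ 2 * δ s)
        =O[nhds t] (fun s => (δ s) ^ 2) := by
      refine Asymptotics.IsBigO.of_bound (2 * ‖x - p‖ ^ 2 / c) ?_
      filter_upwards [hsmall, hpos] with s hs hs0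
      have key : ∀ y, ‖x - y‖ ^ 2 / (2 * s) = ‖x - y‖ ^ 2 / (2 * t) + δ s * ‖x - y‖ ^ 2 := by
        intro y
        simp only [hδdef]
        ring
      have hup : moreau G s x ≤ moreau G t x + ‖x - p‖ ^ 2 * δ s := by
        rw [hMt]
        unfold moreau
        rw [if_neg hs0.ne']
        have h := ciInf_le (hbdd s hs0) p
        have h' := key p
        linarith
      have hlow : moreau G t x + ‖x - p‖ ^ 2 * δ s - 2 * ‖x - p‖ ^ 2 / c * (δ s) ^ 2
          ≤ moreau G s x := by
        rw [hMt]
        conv_rhs => unfold moreau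
        rw [if_neg hs0.ne']
        refine le_ciInf fun y => ?_
        rw [key y]
        have hg := hgrow y
        have en : ‖x - y‖ ^ 2 = ‖x - p‖ ^ 2 - 2 * inner ℝ (x - p) (y - p) + ‖y - p‖ ^ 2 := by
          rw [← norm_sub_sq_real]
          congr 2
          abel
        have hin := abs_real_inner_le_norm (x - p) (y - p)
        have hb1 : δ s * inner ℝ (x - p) (y - p) ≤ |δ s| * (‖x - p‖ * ‖y - p‖) := by
          refine (le_abs_self _).trans ?_
          rw [abs_mul]
          gcongr
        have hb2 : -(c / 2) * ‖y - p‖ ^ 2 ≤ δ s * ‖y - p‖ ^ 2 := by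
          gcongr
          exact (abs_lt.mp hs).1.le
        have hsq : 0 ≤ c / 2 * (‖y - p‖ - 2 / c * (|δ s| * ‖x - p‖)) ^ 2 := by positivity
        have hexp : c / 2 * (‖y - p‖ - 2 / c * (|δ s| * ‖x - p‖)) ^ 2
            = c / 2 * ‖y - p‖ ^ 2 - 2 * (|δ s| * (‖x - p‖ * ‖y - p‖))
              + 2 * ‖x - p‖ ^ 2 / c * (δ s) ^ 2 := by
          rw [← sq_abs (δ s)]
          field_simp
          ring
        have hm : δ s * ‖x - y‖ ^ 2 = ‖x - p‖ ^ 2 * δ s - 2 * (δ s * inner ℝ (x - p) (y - p))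
            + δ s * ‖y - p‖ ^ 2 := by
          rw [en]
          ring
        linarith
      rw [Real.norm_eq_abs, Real.norm_eq_abs, abs_of_nonneg (sq_nonneg (δ s)), abs_le]
      have : 0 ≤ 2 * ‖x - p‖ ^ 2 / c * (δ s) ^ 2 := by positivity
      constructor <;> linarith
    have h2 : δ =O[nhds t] (fun s => ‖s - t‖) := by
      have h := hδ.differentiableAt.isBigO_sub
      simp only [hδt, sub_zero] at h
      exact h.norm_right
    exact h1.trans (h2.pow 2)
  have hd0 := (hbig.hasFDerivAt (by norm_num : 1 < 2)).hasDerivAt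
  have hfin := (hd0.add (hδ.const_mul (‖x - p‖ ^ 2))).add_const (moreau G t x)
  refine (hfin.congr_deriv ?_).congr_of_eventuallyEq (Filter.Eventually.of_forall fun s => ?_)
  · rw [ContinuousLinearMap.zero_apply]
    ring
  · simp only [Pi.add_apply]
    ring
end
end

section
/- Let G : ℝ^d → [0,∞) be locally bounded and weakly convex with modulus ρ_G > 0. Then the Moreau envelope satisfies the Hamilton–Jacobi equation: for every x ∈ ℝ^d and every t ∈ (0, 1/ρ_G), ∂_t M_G^t(x) + (1/2)‖∇M_G^t(x)‖² = 0, where ∂_t M_G^t(x) = −‖x − prox_{tG}(x)‖²/(2t²) is the derivative in t and ∇M_G^t(x) = (x − prox_{tG}(x))/t is the spatial gradient; in particular no Lipschitz continuity of G is assumed. -/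
noncomputable section

variable {d : ℕ}

/-- First-order lower bound at a proximal point. -/
theorem prox_lower
    (G : EuclideanSpace ℝ (Fin d) → ℝ) (ρG : ℝ)
    (hwc : ConvexOn ℝ Set.univ (fun y => G y + ρG / 2 * ‖y‖ ^ 2))
    (x : EuclideanSpace ℝ (Fin d)) (t : ℝ) (ht : 0 < t) (p : EuclideanSpace ℝ (Fin d))
    (hp : p ∈ proxSet G t x) (w : EuclideanSpace ℝ (Fin d)) :
    G p + inner ℝ (x - p) w / t - ρG / 2 * ‖w‖ ^ 2 ≤ G (p + w) := by
  have key : ∀ l ∈ Set.Ioo (0 : ℝ) 1,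
      0 ≤ (G (p + w) - G p + ρG / 2 * ‖w‖ ^ 2 - inner ℝ (x - p) w / t)
        + l * (‖w‖ ^ 2 * (1 / (2 * t) - ρG / 2)) := by
    rintro l ⟨hl0, hl1⟩
    have h1 := hwc.2 (Set.mem_univ p) (Set.mem_univ (p + w)) (by linarith : 0 ≤ 1 - l) hl0.le
      (by ring)
    have e1 : (1 - l) • p + l • (p + w) = p + l • w := by module
    have h2 := hp (p + l • w)
    have e2 : x - (p + l • w) = (x - p) - l • w := by module
    rw [e2, norm_sub_sq_real (x - p), inner_smul_right, norm_smul] at h2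
    simp only [e1, smul_eq_mul] at h1
    rw [norm_add_sq_real, norm_add_sq_real, inner_smul_right, norm_smul] at h1
    rw [Real.norm_eq_abs, mul_pow, sq_abs] at h1 h2
    set I := inner ℝ (x - p) w
    have e3 : (‖x - p‖ ^ 2 - 2 * (l * I) + l ^ 2 * ‖w‖ ^ 2) / (2 * t)
        = ‖x - p‖ ^ 2 / (2 * t) - l * (I / t) + l ^ 2 * ‖w‖ ^ 2 * (1 / (2 * t)) := by
      field_simp
    rw [e3] at h2
    refine nonneg_of_mul_nonneg_right (a := l) ?_ hl0
    nlinarith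
  have hlim : Filter.Tendsto (fun l : ℝ =>
      (G (p + w) - G p + ρG / 2 * ‖w‖ ^ 2 - inner ℝ (x - p) w / t)
        + l * (‖w‖ ^ 2 * (1 / (2 * t) - ρG / 2))) (nhdsWithin 0 (Set.Ioi 0))
      (nhds ((G (p + w) - G p + ρG / 2 * ‖w‖ ^ 2 - inner ℝ (x - p) w / t)
        + 0 * (‖w‖ ^ 2 * (1 / (2 * t) - ρG / 2)))) := by
    apply Filter.Tendsto.mono_left _ nhdsWithin_le_nhds
    apply Continuous.tendsto
    fun_prop
  have h0 := ge_of_tendsto hlim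
    (Filter.mem_of_superset (Ioo_mem_nhdsGT (zero_lt_one)) key)
  linarith

/-- Two-sided bound of the envelope near a proximal point. -/
theorem moreau_bounds
    (G : EuclideanSpace ℝ (Fin d) → ℝ) (hG0 : ∀ x, 0 ≤ G x) (ρG : ℝ) (hρ : 0 < ρG)
    (hwc : ConvexOn ℝ Set.univ (fun y => G y + ρG / 2 * ‖y‖ ^ 2))
    (x : EuclideanSpace ℝ (Fin d)) (t : ℝ) (ht : 0 < t) (p : EuclideanSpace ℝ (Fin d))
    (hp : p ∈ proxSet G t x) (s : ℝ) (hs : s ∈ Set.Ioo (0 : ℝ) (1 / ρG))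
    (z : EuclideanSpace ℝ (Fin d)) :
    |moreau G s z - (G p + ‖z - p‖ ^ 2 / (2 * s))| ≤
      ‖(1 / t) • (x - p) - (1 / s) • (z - p)‖ ^ 2 / (2 * (1 / s - ρG)) := by
  obtain ⟨hs0, hs1⟩ := hs
  have hμ : 0 < 1 / s - ρG := by
    rw [lt_div_iff₀ hρ] at hs1
    rw [sub_pos, lt_div_iff₀ hs0]
    linarith
  set μ := 1 / s - ρG with hμd
  set u := (1 / t) • (x - p) - (1 / s) • (z - p) with hu
  have hM : moreau G s z = ⨅ y : EuclideanSpace ℝ (Fin d), (G y + ‖z - y‖ ^ 2 / (2 * s)) := by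
    simp [moreau, hs0.ne']
  have hup : moreau G s z ≤ G p + ‖z - p‖ ^ 2 / (2 * s) := by
    rw [hM]
    refine ciInf_le ⟨0, ?_⟩ p
    rintro _ ⟨y, rfl⟩
    have := hG0 y
    positivity
  have hlow : G p + ‖z - p‖ ^ 2 / (2 * s) - ‖u‖ ^ 2 / (2 * μ) ≤ moreau G s z := by
    rw [hM]
    refine le_ciInf fun y => ?_
    have h1 := prox_lower G ρG hwc x t ht p hp (y - p)
    rw [add_sub_cancel] at h1
    have e2 : z - y = (z - p) - (y - p) := by abel
    rw [e2, norm_sub_sq_real (z - p)]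
    set w := y - p
    have hiu : inner ℝ u w = inner ℝ (x - p) w / t - inner ℝ (z - p) w / s := by
      rw [hu, inner_sub_left, real_inner_smul_left, real_inner_smul_left]
      ring
    have hsq : 0 ≤ ‖u + μ • w‖ ^ 2 := by positivity
    rw [norm_add_sq_real, inner_smul_right, norm_smul, Real.norm_eq_abs, mul_pow, sq_abs] at hsq
    have hdiv : 0 ≤ ‖u‖ ^ 2 / (2 * μ) + inner ℝ u w + μ / 2 * ‖w‖ ^ 2 := by
      have : ‖u‖ ^ 2 / (2 * μ) + inner ℝ u w + μ / 2 * ‖w‖ ^ 2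
          = (‖u‖ ^ 2 + 2 * (μ * inner ℝ u w) + μ ^ 2 * ‖w‖ ^ 2) / (2 * μ) := by
        field_simp
      rw [this]
      positivity
    have e3 : (‖z - p‖ ^ 2 - 2 * inner ℝ (z - p) w + ‖w‖ ^ 2) / (2 * s)
        = ‖z - p‖ ^ 2 / (2 * s) - inner ℝ (z - p) w / s + 1 / s / 2 * ‖w‖ ^ 2 := by
      field_simp
    rw [e3]
    have e4 : 1 / s = μ + ρG := by rw [hμd]; ring
    rw [e4]
    rw [hiu] at hdiv
    nlinarith
  have : 0 ≤ ‖u‖ ^ 2 / (2 * μ) := by positivity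
  rw [abs_le]
  constructor <;> linarith

/-- Squeezing a derivative. -/
theorem hasFDerivAt_squeeze {E : Type*} [NormedAddCommGroup E] [NormedSpace ℝ E]
    {f g φ : E → ℝ} {g' : E →L[ℝ] ℝ} {x : E} (hg : HasFDerivAt g g' x)
    (hφ : HasFDerivAt φ (0 : E →L[ℝ] ℝ) x) (hφ0 : φ x = 0)
    (h : ∀ᶠ y in nhds x, |f y - g y| ≤ φ y) : HasFDerivAt f g' x := by
  have hx : f x - g x = 0 := by
    have := h.self_of_nhds
    rw [hφ0] at this
    exact abs_nonpos_iff.1 this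
  have hd : HasFDerivAt (fun y => f y - g y) (0 : E →L[ℝ] ℝ) x := by
    rw [hasFDerivAt_iff_isLittleO] at hφ ⊢
    refine Asymptotics.IsBigO.trans_isLittleO (Asymptotics.IsBigO.of_bound 1 ?_) hφ
    filter_upwards [h] with y hy
    simp only [hx, hφ0, zero_apply, sub_zero, one_mul, Real.norm_eq_abs]
    exact hy.trans (le_abs_self _)
  have := hd.add hg
  rw [zero_add] at this
  exact this.congr_of_eventuallyEq (Filter.Eventually.of_forall fun y => by simp)

/-- Congruence for Fréchet derivatives. -/
theorem hasFDerivAt_congr_aux {E : Type*} [NormedAddCommGroup E] [NormedSpace ℝ E]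
    {f g : E → ℝ} {f' g' : E →L[ℝ] ℝ} {x : E} (h : HasFDerivAt f f' x)
    (hfg : ∀ y, g y = f y) (hfg' : ∀ v, g' v = f' v) : HasFDerivAt g g' x := by
  obtain rfl : g = f := funext hfg
  obtain rfl : g' = f' := ContinuousLinearMap.ext hfg'
  exact h

/-- the Moreau envelope satisfies the Hamilton–Jacobi equation
`∂_t M_G^t(x) + (1/2)‖∇M_G^t(x)‖² = 0` on `ℝ^d × (0, 1/ρ_G)`, where the time derivative is
`−‖x − prox_{tG}(x)‖²/(2t²)` and the spatial gradient is `(x − prox_{tG}(x))/t`;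
no Lipschitz continuity of `G` is assumed. -/
theorem moreau_hamilton_jacobi
    (G : EuclideanSpace ℝ (Fin d) → ℝ) (hG0 : ∀ x, 0 ≤ G x) (hloc : LocBdd G)
    (ρG : ℝ) (hρ : 0 < ρG)
    (hwc : ConvexOn ℝ Set.univ (fun y => G y + ρG / 2 * ‖y‖ ^ 2)) :
    ∀ x : EuclideanSpace ℝ (Fin d), ∀ t ∈ Set.Ioo (0 : ℝ) (1 / ρG), ∀ p ∈ proxSet G t x,
      HasDerivAt (fun s => moreau G s x) (-(‖x - p‖ ^ 2 / (2 * t ^ 2))) t ∧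
      HasGradientAt (moreau G t) ((1 / t) • (x - p)) x ∧
      -(‖x - p‖ ^ 2 / (2 * t ^ 2)) + (1 / 2) * ‖(1 / t) • (x - p)‖ ^ 2 = 0 := by
  intro x t ht p hp
  have ht0 : 0 < t := ht.1
  have hB := moreau_bounds G hG0 ρG hρ hwc x t ht0 p hp
  have hμ : 0 < 1 / t - ρG := by
    have := ht.2
    rw [lt_div_iff₀ hρ] at this
    rw [sub_pos, lt_div_iff₀ ht0]
    linarith
  refine ⟨?_, ?_, ?_⟩
  · rw [hasDerivAt_iff_hasFDerivAt]
    have hinv : HasDerivAt (fun s : ℝ => 1 / s) (-(t ^ 2)⁻¹) t := by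
      simpa using hasDerivAt_inv ht0.ne'
    refine hasFDerivAt_squeeze (g := fun s => G p + ‖x - p‖ ^ 2 / (2 * s))
      (φ := fun s => ((1 / t - 1 / s) ^ 2 * ‖x - p‖ ^ 2) / (2 * (1 / s - ρG))) ?_ ?_ ?_ ?_
    · have := (hinv.const_mul (‖x - p‖ ^ 2 / 2)).const_add (G p)
      refine hasFDerivAt_congr_aux this.hasFDerivAt (fun s => ?_) (fun v => ?_)
      · simp only [one_div, div_eq_mul_inv, mul_inv]
        ring
      · simp
        field_simp
        simp
    · have h1 := (((hinv.const_sub (1 / t)).pow 2).mul_const (‖x - p‖ ^ 2)).div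
        ((hinv.sub_const ρG).const_mul 2) (by positivity)
      have h2 := h1.hasFDerivAt
      refine hasFDerivAt_congr_aux h2 (fun s => ?_) (fun v => ?_)
      · simp
      · simp
    · simp
    · filter_upwards [Ioo_mem_nhds ht.1 ht.2] with s hs
      have := hB s hs x
      rwa [← sub_smul, norm_smul, mul_pow, Real.norm_eq_abs, sq_abs] at this
  · rw [hasGradientAt_iff_hasFDerivAt]
    refine hasFDerivAt_squeeze (g := fun z => G p + ‖z - p‖ ^ 2 / (2 * t))
      (φ := fun z => ‖(1 / t) • (x - p) - (1 / t) • (z - p)‖ ^ 2 / (2 * (1 / t - ρG))) ?_ ?_ ?_ ?_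
    · have h1 := (((hasFDerivAt_id x).sub_const p).norm_sq.mul_const (1 / (2 * t))).const_add (G p)
      refine hasFDerivAt_congr_aux h1 (fun z => ?_) (fun v => ?_)
      · simp [div_eq_mul_inv]
      · simp [real_inner_smul_left]
        field_simp
    · have h1 := ((((hasFDerivAt_id x).sub_const p).const_smul (1 / t)).const_sub
        ((1 / t) • (x - p))).norm_sq.mul_const (1 / (2 * (1 / t - ρG)))
      refine hasFDerivAt_congr_aux h1 (fun z => ?_) (fun v => ?_)
      · simp [div_eq_mul_inv]
      · simp
    · simp
    · exact Filter.Eventually.of_forall fun z => hB t ht z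
  · rw [norm_smul, mul_pow, Real.norm_eq_abs, sq_abs]
    field_simp
    ring
end
end

section
/- Let F : ℝ^d → [0,∞) be differentiable with Lipschitz gradient, let G : ℝ^d → [0,∞) be locally bounded and weakly convex with modulus ρ_G > 0, and assume either G is Lipschitz continuous or ∫ exp(−G(x)) dx < ∞. Fix t_max ∈ (0, 1/ρ_G), set U^t = F + M_G^t (with U^0 = F + G), Z_t = ∫ exp(−U^t(x)) dx, π^t(x) = exp(−U^t(x))/Z_t, φ(s) = sup{‖p‖ : p ∈ ∂G(prox_{tG}(x)), ‖x‖ ≤ s, 0 < t ≤ t_max}, and assume K_max := ∫ φ(‖x‖)² exp(−U^{t_max}(x)) dx < ∞. If moreover ∫ ‖x‖^p φ(‖x‖)² exp(−U^{t_max}(x)) dx < ∞ for some p ∈ [1, ∞), then there exists C > 0 such that for all s, t ∈ [0, t_max), ∫ ‖x‖^p |π^s(x) − π^t(x)| dx ≤ C |s−t|; consequently t ↦ π^t is Hölder continuous with exponent 1/p for the Wasserstein-p distance. -/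
noncomputable section

open MeasureTheory
open scoped RealInnerProductSpace

variable {d : ℕ}

/-- Normalization constant `Z_u = ∫ exp(−F(x) − M_G^u(x)) dx`. -/
noncomputable def Zfun (F G : EuclideanSpace ℝ (Fin d) → ℝ) (u : ℝ) : ℝ :=
  ∫ x : EuclideanSpace ℝ (Fin d), Real.exp (-(F x + moreau G u x))

/-- The density `π^u(x) = exp(−F(x) − M_G^u(x))/Z_u`. -/
noncomputable def piDen (F G : EuclideanSpace ℝ (Fin d) → ℝ) (u : ℝ)
    (x : EuclideanSpace ℝ (Fin d)) : ℝ :=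
  Real.exp (-(F x + moreau G u x)) / Zfun F G u

theorem aux_abstract {X : Type*} [MeasurableSpace X] {μ : Measure X} (E : ℝ → X → ℝ) (w W : X → ℝ)
    (T c : ℝ) (hT : 0 < T) (hc : 0 < c) (hE0 : ∀ u x, 0 ≤ E u x)
    (hEi : ∀ u ∈ Set.Icc (0 : ℝ) T, Integrable (E u) μ)
    (hw : Integrable w μ) (hW0 : ∀ x, 0 ≤ W x) (hWm : AEStronglyMeasurable W μ)
    (hw0 : ∀ x, 0 ≤ w x)
    (hWw : Integrable (fun x => W x * w x) μ)
    (hL : ∀ s ∈ Set.Icc (0 : ℝ) T, ∀ t ∈ Set.Icc (0 : ℝ) T, ∀ x, |E s x - E t x| ≤ w x * |s - t|)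
    (hZ : ∀ u ∈ Set.Icc (0 : ℝ) T, c ≤ ∫ x, E u x ∂μ) :
    ∃ C > 0, ∀ s ∈ Set.Icc (0 : ℝ) T, ∀ t ∈ Set.Icc (0 : ℝ) T,
      ∫ x, W x * |E s x / (∫ y, E s y ∂μ) - E t x / (∫ y, E t y ∂μ)| ∂μ ≤ C * |s - t| := by
  set Z : ℝ → ℝ := fun u => ∫ y, E u y ∂μ with hZdef
  set K := ∫ x, w x ∂μ
  set Kp := ∫ x, W x * w x ∂μ
  set I := ∫ x, W x * E T x ∂μ
  have hK : 0 ≤ K := integral_nonneg hw0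
  have hKp : 0 ≤ Kp := integral_nonneg fun x => mul_nonneg (hW0 x) (hw0 x)
  have hI : 0 ≤ I := integral_nonneg fun x => mul_nonneg (hW0 x) (hE0 T x)
  have hTm : T ∈ Set.Icc (0 : ℝ) T := ⟨hT.le, le_rfl⟩
  have hZlip : ∀ s ∈ Set.Icc (0 : ℝ) T, ∀ t ∈ Set.Icc (0 : ℝ) T, |Z s - Z t| ≤ K * |s - t| := by
    intro s hs t ht
    have h1 : Z s - Z t = ∫ x, (E s x - E t x) ∂μ := (integral_sub (hEi s hs) (hEi t ht)).symm
    rw [h1]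
    calc _ ≤ ∫ x, |E s x - E t x| ∂μ := abs_integral_le_integral_abs
      _ ≤ ∫ x, w x * |s - t| ∂μ := by
          apply integral_mono_of_nonneg
          · exact Filter.Eventually.of_forall fun x => abs_nonneg _
          · exact hw.mul_const _
          · exact Filter.Eventually.of_forall fun x => hL s hs t ht x
      _ = K * |s - t| := integral_mul_const _ _
  have hinv : ∀ s ∈ Set.Icc (0 : ℝ) T, ∀ t ∈ Set.Icc (0 : ℝ) T,
      |1 / Z s - 1 / Z t| ≤ K * |s - t| / c ^ 2 := by
    intro s hs t ht
    have a := hZ s hs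
    have b := hZ t ht
    have a' : 0 < Z s := lt_of_lt_of_le hc a
    have b' : 0 < Z t := lt_of_lt_of_le hc b
    have : 1 / Z s - 1 / Z t = (Z t - Z s) / (Z s * Z t) := by field_simp
    rw [this, abs_div, abs_of_pos (mul_pos a' b')]
    apply div_le_div₀ (by positivity)
    · rw [abs_sub_comm]; exact hZlip s hs t ht
    · positivity
    · rw [sq]; exact mul_le_mul a b hc.le a'.le
  have hdec : ∀ s t x, E s x / Z s - E t x / Z t =
      (E s x - E t x) / Z s + E t x * (1 / Z s - 1 / Z t) := by intros; ring
  have hfirst : ∀ s ∈ Set.Icc (0 : ℝ) T, ∀ t ∈ Set.Icc (0 : ℝ) T, ∀ x,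
      |(E s x - E t x) / Z s| ≤ w x * |s - t| / c := by
    intro s hs t ht x
    have a := hZ s hs
    have a' : 0 < Z s := lt_of_lt_of_le hc a
    rw [abs_div, abs_of_pos a']
    exact div_le_div₀ (mul_nonneg (hw0 x) (abs_nonneg _)) (hL s hs t ht x) hc a
  have habs : ∀ t ∈ Set.Icc (0 : ℝ) T, |t - T| ≤ T := by
    intro t ht; rw [abs_le]; constructor <;> linarith [ht.1, ht.2]
  refine ⟨Kp / c + (I + T * Kp) * (K / c ^ 2) + 1, by positivity, ?_⟩
  intro s hs t ht
  have hbig : Kp / c * |s - t| ≤ (Kp / c + (I + T * Kp) * (K / c ^ 2) + 1) * |s - t| := by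
    apply mul_le_mul_of_nonneg_right _ (abs_nonneg _)
    have : 0 ≤ (I + T * Kp) * (K / c ^ 2) := by positivity
    linarith
  change ∫ x, W x * |E s x / Z s - E t x / Z t| ∂μ ≤ _
  by_cases hgood : Integrable (fun x => W x * E T x) μ
  · have hb : ∀ x, W x * |E s x / Z s - E t x / Z t| ≤
        (W x * w x) * (|s - t| / c) + (W x * E T x + T * (W x * w x)) * (K * |s - t| / c ^ 2) := by
      intro x
      have h1 : |E s x / Z s - E t x / Z t| ≤
          w x * |s - t| / c + (E T x + w x * T) * (K * |s - t| / c ^ 2) := by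
        rw [hdec]
        refine (abs_add_le _ _).trans (add_le_add (hfirst s hs t ht x) ?_)
        rw [abs_mul, abs_of_nonneg (hE0 t x)]
        apply mul_le_mul _ (hinv s hs t ht) (abs_nonneg _)
        · exact add_nonneg (hE0 _ _) (mul_nonneg (hw0 x) hT.le)
        · have := (le_abs_self _).trans (hL t ht T hTm x)
          have h2 := mul_le_mul_of_nonneg_left (habs t ht) (hw0 x)
          linarith
      calc _ ≤ W x * (w x * |s - t| / c + (E T x + w x * T) * (K * |s - t| / c ^ 2)) :=
            mul_le_mul_of_nonneg_left h1 (hW0 x)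
        _ = _ := by ring
    have i1 := hWw.mul_const (|s - t| / c)
    have i2 : Integrable (fun x => (W x * E T x + T * (W x * w x)) * (K * |s - t| / c ^ 2)) μ :=
      (hgood.add (hWw.const_mul T)).mul_const (K * |s - t| / c ^ 2)
    have := integral_mono_of_nonneg (μ := μ)
      (Filter.Eventually.of_forall fun x => mul_nonneg (hW0 x) (abs_nonneg _))
      (i1.add i2) (Filter.Eventually.of_forall hb)
    refine this.trans ?_
    have e : ∫ x, ((W x * w x) * (|s - t| / c) +
        (W x * E T x + T * (W x * w x)) * (K * |s - t| / c ^ 2)) ∂μ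
        = Kp * (|s - t| / c) + (I + T * Kp) * (K * |s - t| / c ^ 2) := by
      rw [integral_add i1 i2, integral_mul_const, integral_mul_const]
      congr 2
      rw [← integral_const_mul]
      exact integral_add hgood (hWw.const_mul T)
    refine (le_of_eq e).trans ?_
    have : Kp * (|s - t| / c) + (I + T * Kp) * (K * |s - t| / c ^ 2) + |s - t| =
      (Kp / c + (I + T * Kp) * (K / c ^ 2) + 1) * |s - t| := by ring
    linarith [abs_nonneg (s - t)]
  · by_cases hZe : Z s = Z t
    · refine le_trans ?_ hbig
      have hb : ∀ x, W x * |E s x / Z s - E t x / Z t| ≤ (W x * w x) * (|s - t| / c) := by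
        intro x
        have h1 := hfirst s hs t ht x
        rw [← hZe, ← sub_div]
        calc _ ≤ _ := mul_le_mul_of_nonneg_left h1 (hW0 x)
          _ = _ := by ring
      have := integral_mono_of_nonneg (μ := μ)
        (Filter.Eventually.of_forall fun x => mul_nonneg (hW0 x) (abs_nonneg _))
        (hWw.mul_const (|s - t| / c)) (Filter.Eventually.of_forall hb)
      refine this.trans (le_of_eq ?_)
      rw [integral_mul_const]; ring
    · rw [integral_undef]
      · positivity
      intro hf
      apply hgood
      have a' : 0 < Z s := lt_of_lt_of_le hc (hZ s hs)
      have b' : 0 < Z t := lt_of_lt_of_le hc (hZ t ht)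
      have hδ : 0 < |1 / Z s - 1 / Z t| := by
        rw [abs_pos, sub_ne_zero]
        intro h
        apply hZe
        field_simp at h
        exact h.symm
      set δ := |1 / Z s - 1 / Z t|
      have hi := ((hf.add (hWw.mul_const (|s - t| / c))).div_const δ).add (hWw.const_mul T)
      refine hi.mono' (hWm.mul (hEi T hTm).1) (Filter.Eventually.of_forall fun x => ?_)
      rw [Real.norm_of_nonneg (mul_nonneg (hW0 x) (hE0 T x))]
      change W x * E T x ≤ (W x * |E s x / Z s - E t x / Z t| + W x * w x * (|s - t| / c)) / δ
        + T * (W x * w x)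
      have h1 : E t x * δ ≤ |E s x / Z s - E t x / Z t| + w x * |s - t| / c := by
        have h2 : E t x * (1 / Z s - 1 / Z t) =
          (E s x / Z s - E t x / Z t) - (E s x - E t x) / Z s := by ring
        have h3 : E t x * δ = |E t x * (1 / Z s - 1 / Z t)| := by
          rw [abs_mul, abs_of_nonneg (hE0 t x)]
        rw [h3, h2]
        refine (abs_sub _ _).trans ?_
        linarith [hfirst s hs t ht x]
      have h4 : E T x ≤ E t x + w x * T := by
        have := (neg_abs_le _).trans' (neg_le_neg (hL t ht T hTm x))
        have h2 := mul_le_mul_of_nonneg_left (habs t ht) (hw0 x)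
        linarith
      have h5 : E t x ≤ (|E s x / Z s - E t x / Z t| + w x * |s - t| / c) / δ := by
        rwa [le_div_iff₀ hδ]
      calc W x * E T x ≤ W x * ((|E s x / Z s - E t x / Z t| + w x * |s - t| / c) / δ + w x * T) :=
            mul_le_mul_of_nonneg_left (by linarith) (hW0 x)
        _ = _ := by ring

theorem aux_bdd (G : EuclideanSpace ℝ (Fin d) → ℝ) (hG0 : ∀ x, 0 ≤ G x) (t : ℝ) (ht : 0 < t)
    (x : EuclideanSpace ℝ (Fin d)) :
    BddBelow (Set.range fun y => G y + ‖x - y‖ ^ 2 / (2 * t)) := by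
  refine ⟨0, ?_⟩
  rintro _ ⟨y, rfl⟩
  have := hG0 y
  positivity

theorem aux_prox_exists (G : EuclideanSpace ℝ (Fin d) → ℝ) (hG0 : ∀ x, 0 ≤ G x)
    (hGc : Continuous G) (t : ℝ) (ht : 0 < t) (x : EuclideanSpace ℝ (Fin d)) :
    ∃ q, q ∈ proxSet G t x ∧ moreau G t x = G q + ‖x - q‖ ^ 2 / (2 * t) := by
  have hco : Filter.Tendsto (fun y => G y + ‖x - y‖ ^ 2 / (2 * t))
      (Filter.cocompact _) Filter.atTop := by
    have h1 : Filter.Tendsto (fun y : EuclideanSpace ℝ (Fin d) => ‖x - y‖)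
        (Filter.cocompact _) Filter.atTop := by
      have := tendsto_dist_left_cocompact_atTop x
      exact this.congr fun y => dist_eq_norm x y
    have h2 := ((Filter.tendsto_pow_atTop (two_ne_zero)).comp h1).atTop_div_const
      (show 0 < 2 * t by positivity)
    refine Filter.tendsto_atTop_mono (fun y => ?_) h2
    simp only [Function.comp]
    linarith [hG0 y]
  obtain ⟨q, hq⟩ := Continuous.exists_forall_le (by fun_prop) hco
  refine ⟨q, hq, ?_⟩
  rw [moreau, if_neg ht.ne']
  apply le_antisymm
  · exact ciInf_le (aux_bdd G hG0 t ht x) q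
  · exact le_ciInf hq

theorem aux_subdiff (G : EuclideanSpace ℝ (Fin d) → ℝ) (t : ℝ) (ht : 0 < t)
    (x q : EuclideanSpace ℝ (Fin d)) (hq : q ∈ proxSet G t x) :
    (1 / t) • (x - q) ∈ regSubdiff G q := by
  intro ε hε
  have h : ∀ᶠ y in nhds q, ‖y - q‖ < 2 * t * ε := by
    have := Metric.ball_mem_nhds q (show 0 < 2 * t * ε by positivity)
    filter_upwards [this] with y hy
    simpa [dist_eq_norm] using hy
  filter_upwards [h.filter_mono nhdsWithin_le_nhds] with y hy
  have h1 := hq y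
  have h2 : ‖x - y‖ ^ 2 = ‖x - q‖ ^ 2 - 2 * ⟪x - q, y - q⟫ + ‖y - q‖ ^ 2 := by
    rw [← norm_sub_sq_real]; congr 2; abel
  rw [h2] at h1
  rw [real_inner_smul_left]
  have h3 : ‖y - q‖ ^ 2 / (2 * t) ≤ ε * ‖y - q‖ := by
    rw [div_le_iff₀ (by positivity)]
    nlinarith [norm_nonneg (y - q)]
  have h4 : (‖x - q‖ ^ 2 - 2 * ⟪x - q, y - q⟫ + ‖y - q‖ ^ 2) / (2 * t) =
    ‖x - q‖ ^ 2 / (2 * t) - 1 / t * ⟪x - q, y - q⟫ + ‖y - q‖ ^ 2 / (2 * t) := by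
    field_simp
  rw [h4] at h1
  linarith

theorem aux_anti (G : EuclideanSpace ℝ (Fin d) → ℝ) (hG0 : ∀ x, 0 ≤ G x)
    (s t : ℝ) (hs : 0 ≤ s) (hst : s ≤ t) (x : EuclideanSpace ℝ (Fin d)) :
    moreau G t x ≤ moreau G s x := by
  rcases hst.eq_or_lt with rfl | hlt
  · exact le_rfl
  have ht : 0 < t := hs.trans_lt hlt
  rcases hs.eq_or_lt with rfl | hs0
  · rw [moreau, if_neg ht.ne', moreau, if_pos rfl]
    have := ciInf_le (aux_bdd G hG0 t ht x) x
    simpa using this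
  · rw [moreau, if_neg ht.ne', moreau, if_neg hs0.ne']
    apply ciInf_mono (aux_bdd G hG0 t ht x)
    intro y
    gcongr

theorem aux_lip (G : EuclideanSpace ℝ (Fin d) → ℝ) (hG0 : ∀ x, 0 ≤ G x) (hGc : Continuous G)
    (tmax : ℝ) (x : EuclideanSpace ℝ (Fin d)) (b : ℝ)
    (hb : ∀ t q v, 0 < t → t ≤ tmax → q ∈ proxSet G t x → v ∈ regSubdiff G q → ‖v‖ ≤ b)
    (s t : ℝ) (hs : 0 ≤ s) (hst : s ≤ t) (ht : t ≤ tmax) :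
    moreau G s x - moreau G t x ≤ b ^ 2 * (t - s) := by
  have hdist : ∀ t q, 0 < t → t ≤ tmax → q ∈ proxSet G t x → ‖x - q‖ ≤ t * b := by
    intro t q ht htm hq
    have := hb t q _ ht htm hq (aux_subdiff G t ht x q hq)
    rw [norm_smul, Real.norm_of_nonneg (by positivity)] at this
    rw [one_div, inv_mul_le_iff₀ ht] at this
    exact this
  -- one step
  have hstep : ∀ s t, 0 < s → s ≤ t → t ≤ 2 * s → t ≤ tmax →
      moreau G s x - moreau G t x ≤ b ^ 2 * (t - s) := by
    intro s t hs hst h2 ht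
    have ht0 : 0 < t := hs.trans_le hst
    obtain ⟨q, hq, hm⟩ := aux_prox_exists G hG0 hGc t ht0 x
    have hd := hdist t q ht0 ht hq
    have h1 : moreau G s x ≤ G q + ‖x - q‖ ^ 2 / (2 * s) := by
      rw [moreau, if_neg hs.ne']
      exact ciInf_le (aux_bdd G hG0 s hs x) q
    have hsq : ‖x - q‖ ^ 2 ≤ (t * b) ^ 2 := pow_le_pow_left₀ (norm_nonneg _) hd 2
    have e : ‖x - q‖ ^ 2 / (2 * s) - ‖x - q‖ ^ 2 / (2 * t) =
        ‖x - q‖ ^ 2 * ((t - s) / (2 * s * t)) := by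
      field_simp
    have h3 : ‖x - q‖ ^ 2 * ((t - s) / (2 * s * t)) ≤ (t * b) ^ 2 * ((t - s) / (2 * s * t)) := by
      apply mul_le_mul_of_nonneg_right hsq
      apply div_nonneg (by linarith) (by positivity)
    have h4 : (t * b) ^ 2 * ((t - s) / (2 * s * t)) = b ^ 2 * (t - s) * (t / (2 * s)) := by
      field_simp
    have h5 : b ^ 2 * (t - s) * (t / (2 * s)) ≤ b ^ 2 * (t - s) * 1 := by
      apply mul_le_mul_of_nonneg_left
      · rw [div_le_one (by positivity)]; exact h2
      · exact mul_nonneg (sq_nonneg _) (by linarith)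
    rw [hm]
    linarith
  have hiter : ∀ n : ℕ, ∀ s t, 0 < s → s ≤ t → t ≤ 2 ^ n * s → t ≤ tmax →
      moreau G s x - moreau G t x ≤ b ^ 2 * (t - s) := by
    intro n
    induction n with
    | zero =>
      intro s t hs hst h2 ht
      exact hstep s t hs hst (by simp at h2; linarith) ht
    | succ n ih =>
      intro s t hs hst h2 ht
      by_cases h : t ≤ 2 * s
      · exact hstep s t hs hst h ht
      · push Not at h
        have a := hstep s (2 * s) hs (by linarith) le_rfl (by linarith)
        have c := ih (2 * s) t (by linarith) h.le (by rw [pow_succ] at h2; linarith) ht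
        linarith
  have hpos : ∀ s t, 0 < s → s ≤ t → t ≤ tmax →
      moreau G s x - moreau G t x ≤ b ^ 2 * (t - s) := by
    intro s t hs hst ht
    obtain ⟨n, hn⟩ := pow_unbounded_of_one_lt (t / s) (one_lt_two)
    exact hiter n s t hs hst ((div_le_iff₀ hs).1 hn.le) ht
  rcases hs.eq_or_lt with rfl | hs0
  · rcases hst.eq_or_lt with rfl | ht0
    · simp
    rw [show moreau G 0 x = G x by simp [moreau]]
    -- limit
    have hex : ∀ u : ℝ, ∃ q, 0 < u → q ∈ proxSet G u x ∧
        moreau G u x = G q + ‖x - q‖ ^ 2 / (2 * u) := by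
      intro u
      by_cases hu : 0 < u
      · obtain ⟨q, hq⟩ := aux_prox_exists G hG0 hGc u hu x
        exact ⟨q, fun _ => hq⟩
      · exact ⟨x, fun h => absurd h hu⟩
    choose q hq using hex
    have hmem : ∀ᶠ u in nhdsWithin (0 : ℝ) (Set.Ioi 0), 0 < u ∧ u < t :=
      Ioo_mem_nhdsGT ht0
    have hqt : Filter.Tendsto q (nhdsWithin (0 : ℝ) (Set.Ioi 0)) (nhds x) := by
      rw [tendsto_iff_norm_sub_tendsto_zero]
      have h0 : Filter.Tendsto (fun u : ℝ => u * b) (nhdsWithin (0 : ℝ) (Set.Ioi 0)) (nhds 0) := by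
        have : Filter.Tendsto (fun u : ℝ => u * b) (nhds 0) (nhds (0 * b)) :=
          (continuous_id.mul continuous_const).tendsto 0
        rw [zero_mul] at this
        exact this.mono_left nhdsWithin_le_nhds
      refine squeeze_zero' (Filter.Eventually.of_forall fun _ => norm_nonneg _) ?_ h0
      filter_upwards [hmem] with u hu
      rw [norm_sub_rev]
      exact hdist u (q u) hu.1 (by linarith [hu.2]) (hq u hu.1).1
    have hG1 := (hGc.tendsto x).comp hqt
    have hlim := hG1.sub_const (moreau G t x)
    refine le_of_tendsto hlim ?_
    filter_upwards [hmem] with u hu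
    have h1 := hpos u t hu.1 hu.2.le ht
    have h2 := (hq u hu.1).2
    have h3 : 0 ≤ ‖x - q u‖ ^ 2 / (2 * u) := by
      have := hu.1
      positivity
    have h4 : 0 ≤ b ^ 2 * u := mul_nonneg (sq_nonneg _) hu.1.le
    simp only [Function.comp]
    linarith
  · exact hpos s t hs0 hst ht

/-- under the additional `p`-moment integrability assumption there is `C > 0`
such that `∫ ‖x‖^p |π^s(x) − π^t(x)| dx ≤ C|s−t|`; consequently `t ↦ π^t` is Hölder
continuous with exponent `1/p` for the Wasserstein-`p` distance, expressed via the bound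
`W_p(π^s, π^t) ≤ (∫ 2^{p−1}‖x‖^p |π^s − π^t|)^{1/p} ≤ (2^{p−1} C |s−t|)^{1/p}`. -/
theorem piCurve_wasserstein_holder
    (F G : EuclideanSpace ℝ (Fin d) → ℝ)
    (hF0 : ∀ x, 0 ≤ F x) (hG0 : ∀ x, 0 ≤ G x)
    (hFdiff : Differentiable ℝ F)
    (hFlip : ∃ L : NNReal, LipschitzWith L (fun x => gradient F x))
    (hloc : LocBdd G) (ρG : ℝ) (hρ : 0 < ρG)
    (hwc : ConvexOn ℝ Set.univ (fun y => G y + ρG / 2 * ‖y‖ ^ 2))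
    (hGint : (∃ L : NNReal, LipschitzWith L G) ∨
      Integrable (fun x : EuclideanSpace ℝ (Fin d) => Real.exp (-G x)))
    (tmax : ℝ) (htmax : tmax ∈ Set.Ioo (0 : ℝ) (1 / ρG))
    (φ : ℝ → ℝ)
    (hφ : ∀ (x p' v : EuclideanSpace ℝ (Fin d)) (t : ℝ), 0 < t → t ≤ tmax →
      p' ∈ proxSet G t x → v ∈ regSubdiff G p' → ‖v‖ ≤ φ ‖x‖)
    (hKint : Integrable (fun x : EuclideanSpace ℝ (Fin d) =>
      (φ ‖x‖) ^ 2 * Real.exp (-(F x + moreau G tmax x))))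
    (hZint : ∀ u ∈ Set.Icc (0 : ℝ) tmax,
      Integrable (fun x : EuclideanSpace ℝ (Fin d) => Real.exp (-(F x + moreau G u x))))
    (p : ℝ) (hp : 1 ≤ p)
    (hpint : Integrable (fun x : EuclideanSpace ℝ (Fin d) =>
      ‖x‖ ^ p * (φ ‖x‖) ^ 2 * Real.exp (-(F x + moreau G tmax x)))) :
    ∃ C > 0, ∀ s ∈ Set.Ico (0 : ℝ) tmax, ∀ t ∈ Set.Ico (0 : ℝ) tmax,
      (∫ x : EuclideanSpace ℝ (Fin d), ‖x‖ ^ p * |piDen F G s x - piDen F G t x|) ≤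
        C * |s - t| ∧
      (∫ x : EuclideanSpace ℝ (Fin d),
          (2 : ℝ) ^ (p - 1) * ‖x‖ ^ p * |piDen F G s x - piDen F G t x|) ^ (1 / p) ≤
        ((2 : ℝ) ^ (p - 1) * C * |s - t|) ^ (1 / p) := by
  have hGc : Continuous G := by
    have h1 : Continuous (fun y => G y + ρG / 2 * ‖y‖ ^ 2) :=
      continuousOn_univ.1 (hwc.continuousOn isOpen_univ)
    have h2 : Continuous (fun y : EuclideanSpace ℝ (Fin d) => ρG / 2 * ‖y‖ ^ 2) := by fun_prop
    have h3 : G = fun y => (G y + ρG / 2 * ‖y‖ ^ 2) - ρG / 2 * ‖y‖ ^ 2 := by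
      funext y; ring
    rw [h3]
    exact h1.sub h2
  have hT : 0 < tmax := htmax.1
  set E : ℝ → EuclideanSpace ℝ (Fin d) → ℝ := fun u x => Real.exp (-(F x + moreau G u x)) with hE
  have hanti := aux_anti G hG0
  have hmono : ∀ s t, 0 ≤ s → s ≤ t → ∀ x, E s x ≤ E t x := by
    intro s t hs hst x
    apply Real.exp_le_exp.2
    linarith [hanti s t hs hst x]
  have hL1 : ∀ s t, 0 ≤ s → s ≤ t → t ≤ tmax → ∀ x,
      E t x - E s x ≤ (φ ‖x‖) ^ 2 * E tmax x * (t - s) := by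
    intro s t hs hst ht x
    have hl := aux_lip G hG0 hGc tmax x (φ ‖x‖)
      (fun t q v h1 h2 h3 h4 => hφ x q v t h1 h2 h3 h4) s t hs hst ht
    set δ := moreau G s x - moreau G t x with hδ
    have e : E s x = E t x * Real.exp (-δ) := by
      simp only [hE]
      rw [← Real.exp_add]; congr 1; rw [hδ]; ring
    have h1 := Real.add_one_le_exp (-δ)
    have hδ0 : 0 ≤ δ := by linarith [hanti s t hs hst x]
    have hpos : 0 < E t x := Real.exp_pos _
    have hm := hmono t tmax (hs.trans hst) ht x
    calc E t x - E s x = E t x * (1 - Real.exp (-δ)) := by rw [e]; ring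
      _ ≤ E t x * δ := mul_le_mul_of_nonneg_left (by linarith) hpos.le
      _ ≤ E tmax x * δ := mul_le_mul_of_nonneg_right hm hδ0
      _ ≤ E tmax x * ((φ ‖x‖) ^ 2 * (t - s)) :=
        mul_le_mul_of_nonneg_left hl (Real.exp_pos _).le
      _ = _ := by ring
  have hL : ∀ s ∈ Set.Icc (0 : ℝ) tmax, ∀ t ∈ Set.Icc (0 : ℝ) tmax, ∀ x,
      |E s x - E t x| ≤ (φ ‖x‖) ^ 2 * E tmax x * |s - t| := by
    intro s hs t ht x
    rcases le_total s t with h | h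
    · rw [abs_sub_comm, abs_of_nonneg (sub_nonneg.2 (hmono s t hs.1 h x)), abs_sub_comm,
        abs_of_nonneg (sub_nonneg.2 h)]
      exact hL1 s t hs.1 h ht.2 x
    · rw [abs_of_nonneg (sub_nonneg.2 (hmono t s ht.1 h x)),
        abs_of_nonneg (sub_nonneg.2 h)]
      exact hL1 t s ht.1 h hs.2 x
  have h0m : (0 : ℝ) ∈ Set.Icc (0 : ℝ) tmax := ⟨le_rfl, hT.le⟩
  obtain ⟨C, hC, hCb⟩ := aux_abstract (μ := volume) E (fun x => (φ ‖x‖) ^ 2 * E tmax x)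
    (fun x => ‖x‖ ^ p) tmax (∫ x, E 0 x) hT (integral_exp_pos (hZint 0 h0m))
    (fun u x => (Real.exp_pos _).le) hZint hKint (fun x => by positivity)
    (by
      apply Continuous.aestronglyMeasurable
      exact continuous_norm.rpow_const (fun x => Or.inr (by linarith)))
    (fun x => mul_nonneg (sq_nonneg _) (Real.exp_pos _).le)
    (by simpa only [mul_assoc] using hpint) hL
    (fun u hu => integral_mono (hZint 0 h0m) (hZint u hu) (hmono 0 u le_rfl hu.1))
  refine ⟨C, hC, fun s hs t ht => ?_⟩
  have h1 : (∫ x : EuclideanSpace ℝ (Fin d), ‖x‖ ^ p * |piDen F G s x - piDen F G t x|) ≤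
      C * |s - t| := hCb s ⟨hs.1, hs.2.le⟩ t ⟨ht.1, ht.2.le⟩
  refine ⟨h1, ?_⟩
  apply Real.rpow_le_rpow
  · exact integral_nonneg fun x => by positivity
  · simp only [mul_assoc]
    rw [integral_const_mul]
    exact mul_le_mul_of_nonneg_left h1 (by positivity)
  · positivity
end
end

section
/- Let G : ℝ^d → [0,∞) be continuous and let t > 0. Define the diffusion-based potential with temperature T > 0 by G^t_T(x) = −T log( (2πTt)^{−d/2} ∫_{ℝ^d} exp( −G(y)/T − ‖x−y‖²/(2Tt) ) dy ). Then for every x ∈ ℝ^d, G^t_T(x) → M_G^t(x) as T → 0⁺; that is, the Moreau envelope (the DAZ potential) is the zero-temperature limit of the diffusion potential. -/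
noncomputable section

open MeasureTheory Filter Topology

variable {d : ℕ}

/-- The diffusion-based potential with temperature `T`:
`G^t_T(x) = −T log((2πTt)^{−d/2} ∫ exp(−G(y)/T − ‖x−y‖²/(2Tt)) dy)`. -/
noncomputable def diffPot (G : EuclideanSpace ℝ (Fin d) → ℝ) (t T : ℝ)
    (x : EuclideanSpace ℝ (Fin d)) : ℝ :=
  -T * Real.log ((2 * Real.pi * T * t) ^ (-(d : ℝ) / 2) *
    ∫ y : EuclideanSpace ℝ (Fin d), Real.exp (-G y / T - ‖x - y‖ ^ 2 / (2 * T * t)))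

lemma gauss_integrable (x : EuclideanSpace ℝ (Fin d)) {b : ℝ} (hb : 0 < b) :
    Integrable (fun y : EuclideanSpace ℝ (Fin d) => Real.exp (-b * ‖x - y‖ ^ 2)) := by
  have h : Integrable (fun y : EuclideanSpace ℝ (Fin d) => Real.exp (-b * ‖y‖ ^ 2)) := by
    by_contra hn
    have h1 := GaussianFourier.integral_rexp_neg_mul_sq_norm
      (V := EuclideanSpace ℝ (Fin d)) hb
    rw [integral_undef hn] at h1
    have : 0 < (Real.pi / b) ^ ((Module.finrank ℝ (EuclideanSpace ℝ (Fin d)) : ℝ) / 2) := by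
      positivity
    linarith
  exact h.comp_sub_left x

/-- Laplace principle for `F ≥ m = inf F`. -/
lemma laplace_aux (F : EuclideanSpace ℝ (Fin d) → ℝ) (hF : Continuous F)
    (hbdd : BddBelow (Set.range F))
    (hint : ∀ T : ℝ, 0 < T → Integrable (fun y => Real.exp (-F y / T))) :
    Tendsto (fun T : ℝ => -T * Real.log (∫ y, Real.exp (-F y / T))) (𝓝[>] 0)
      (𝓝 (⨅ y, F y)) := by
  set m := ⨅ y, F y with hm
  have hid : Tendsto (fun T : ℝ => T) (𝓝[>] 0) (𝓝 0) := tendsto_nhdsWithin_of_tendsto_nhds tendsto_id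
  have hmle : ∀ y, m ≤ F y := fun y => ciInf_le hbdd y
  have hpos : ∀ T : ℝ, 0 < T → 0 < ∫ y, Real.exp (-F y / T) := fun T hT =>
    integral_exp_pos (hint T hT)
  rw [tendsto_order]
  constructor
  · intro a ha
    set C := ∫ y, Real.exp (-F y / 1) with hC
    have hCpos : 0 < C := hpos 1 one_pos
    have hl : Tendsto (fun T : ℝ => (1 - T) * m - T * Real.log C) (𝓝[>] 0) (𝓝 m) := by
      have := ((hid.const_sub 1).mul_const m).sub (hid.mul_const (Real.log C))
      simpa using this
    have hT1 : ∀ᶠ T : ℝ in 𝓝[>] 0, T < 1 := hid.eventually_lt_const one_pos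
    filter_upwards [hl.eventually_const_lt ha, hT1, self_mem_nhdsWithin] with T h1 h2 hT
    have hT : 0 < T := hT
    refine h1.trans_le ?_
    have hle : ∫ y, Real.exp (-F y / T) ≤ Real.exp (-((1 - T) * m) / T) * C := by
      rw [hC, ← integral_const_mul]
      refine integral_mono (hint T hT) ((hint 1 one_pos).const_mul _) fun y => ?_
      simp only
      rw [← Real.exp_add]
      apply Real.exp_le_exp.2
      have : -((1 - T) * m) / T + -F y / 1 - -F y / T = (1 - T) * (F y - m) / T := by
        field_simp; ring
      have h3 : 0 ≤ (1 - T) * (F y - m) / T :=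
        div_nonneg (mul_nonneg (by linarith) (by linarith [hmle y])) hT.le
      linarith
    have hlog := Real.log_le_log (hpos T hT) hle
    rw [Real.log_mul (Real.exp_pos _).ne' hCpos.ne', Real.log_exp] at hlog
    have := mul_le_mul_of_nonneg_left hlog hT.le
    have e : T * (-((1 - T) * m) / T + Real.log C) = -((1 - T) * m) + T * Real.log C := by
      field_simp
    linarith
  · intro b hb
    obtain ⟨c, hmc, hcb⟩ := exists_between hb
    obtain ⟨y0, hy0⟩ := exists_lt_of_ciInf_lt hmc
    obtain ⟨δ, hδ, hball⟩ := Metric.isOpen_iff.1 (isOpen_Iio.preimage hF : IsOpen (F ⁻¹' Set.Iio c)) y0 hy0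
    set V := (volume (Metric.ball y0 δ)).toReal with hV
    have hVpos : 0 < V := ENNReal.toReal_pos (Metric.measure_ball_pos _ _ hδ).ne'
      measure_ball_lt_top.ne
    have hl : Tendsto (fun T : ℝ => c - T * Real.log V) (𝓝[>] 0) (𝓝 c) := by
      simpa using (hid.mul_const (Real.log V)).const_sub c
    filter_upwards [hl.eventually_lt_const hcb, self_mem_nhdsWithin] with T h1 hT
    have hT : 0 < T := hT
    refine lt_of_le_of_lt ?_ h1
    have hle : V * Real.exp (-c / T) ≤ ∫ y, Real.exp (-F y / T) := by
      calc V * Real.exp (-c / T) = ∫ y in Metric.ball y0 δ, Real.exp (-c / T) := by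
            rw [setIntegral_const, smul_eq_mul]; rfl
        _ ≤ ∫ y in Metric.ball y0 δ, Real.exp (-F y / T) := by
            refine setIntegral_mono_on (integrableOn_const measure_ball_lt_top.ne)
              (hint T hT).integrableOn measurableSet_ball fun y hy => ?_
            have : F y < c := hball hy
            apply Real.exp_le_exp.2
            gcongr
        _ ≤ _ := setIntegral_le_integral (hint T hT)
            (Eventually.of_forall fun y => (Real.exp_pos _).le)
    have hlog := Real.log_le_log (by positivity) hle
    rw [Real.log_mul hVpos.ne' (Real.exp_pos _).ne', Real.log_exp] at hlog
    have := mul_le_mul_of_nonneg_left hlog hT.le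
    have e : T * (Real.log V + -c / T) = T * Real.log V - c := by
      field_simp
      ring
    linarith

/-- the Moreau envelope (DAZ potential) is the zero-temperature limit of the
diffusion potential: `G^t_T(x) → M_G^t(x)` as `T → 0⁺`, for every `x`. -/
theorem diffPot_tendsto_moreau
    (G : EuclideanSpace ℝ (Fin d) → ℝ) (hG0 : ∀ x, 0 ≤ G x) (hGcont : Continuous G)
    (t : ℝ) (ht : 0 < t) :
    ∀ x : EuclideanSpace ℝ (Fin d),
      Tendsto (fun T => diffPot G t T x) (𝓝[>] (0 : ℝ)) (𝓝 (moreau G t x)) := by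
  intro x
  have hF0 : ∀ y, 0 ≤ G y + ‖x - y‖ ^ 2 / (2 * t) := fun y => by
    have := hG0 y
    positivity
  have hFc : Continuous fun y => G y + ‖x - y‖ ^ 2 / (2 * t) := by fun_prop
  have hint : ∀ T : ℝ, 0 < T →
      Integrable (fun y => Real.exp (-(G y + ‖x - y‖ ^ 2 / (2 * t)) / T)) := by
    intro T hT
    refine (gauss_integrable x (b := 1 / (2 * t * T)) (by positivity)).mono'
      (by fun_prop) (Eventually.of_forall fun y => ?_)
    rw [Real.norm_eq_abs, abs_of_pos (Real.exp_pos _)]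
    apply Real.exp_le_exp.2
    have h1 : 0 ≤ G y / T := div_nonneg (hG0 y) hT.le
    have h2 : -(G y + ‖x - y‖ ^ 2 / (2 * t)) / T
        = -(1 / (2 * t * T)) * ‖x - y‖ ^ 2 - G y / T := by
      field_simp
      ring
    linarith
  have hL := laplace_aux _ hFc ⟨0, by rintro _ ⟨y, rfl⟩; exact hF0 y⟩ hint
  have hlogT : Tendsto (fun T : ℝ => (d : ℝ) / 2 / (2 * Real.pi * t) *
      ((2 * Real.pi * T * t) * Real.log (2 * Real.pi * T * t))) (𝓝[>] 0) (𝓝 0) := by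
    have hc : Continuous (fun T : ℝ => (d : ℝ) / 2 / (2 * Real.pi * t) *
      ((2 * Real.pi * T * t) * Real.log (2 * Real.pi * T * t))) :=
      continuous_const.mul (Real.continuous_mul_log.comp
        (by fun_prop : Continuous fun T : ℝ => 2 * Real.pi * T * t))
    have := hc.tendsto 0
    simp only [mul_zero, zero_mul] at this
    exact this.mono_left nhdsWithin_le_nhds
  have hsum := hlogT.add hL
  rw [zero_add] at hsum
  rw [moreau, if_neg ht.ne']
  refine hsum.congr' ?_
  filter_upwards [self_mem_nhdsWithin] with T hT
  have hT : 0 < T := hT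
  have hpi := Real.pi_pos
  have hI : (∫ y, Real.exp (-G y / T - ‖x - y‖ ^ 2 / (2 * T * t)))
      = ∫ y, Real.exp (-(G y + ‖x - y‖ ^ 2 / (2 * t)) / T) := by
    congr 1
    ext y
    congr 1
    field_simp
    ring
  have hp : 0 < 2 * Real.pi * T * t := by positivity
  rw [diffPot, hI, Real.log_mul (Real.rpow_pos_of_pos hp _).ne'
    (integral_exp_pos (hint T hT)).ne', Real.log_rpow hp]
  field_simp
  ring
end
end

section
/- Let G : ℝ^d → [0,∞) be differentiable with locally Lipschitz continuous gradient and let t > 0. Define G^t_T(x) = −T log( (2πTt)^{−d/2} ∫_{ℝ^d} exp( −G(y)/T − ‖x−y‖²/(2Tt) ) dy ) for T > 0, and assume that for every x the infimum defining M_G^t(x) is attained. Then G^t_T converges to M_G^t uniformly on compact subsets of ℝ^d as T → 0⁺: for every compact K ⊆ ℝ^d and every ε > 0 there exists T₀ > 0 such that |G^t_T(x) − M_G^t(x)| ≤ ε for all x ∈ K and 0 < T < T₀. -/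
noncomputable section

open MeasureTheory Filter Topology

variable {d : ℕ}

lemma gauss_integrable_aux (b : ℝ) (hb : 0 < b) :
    Integrable (fun v : EuclideanSpace ℝ (Fin d) => Real.exp (-(b * ‖v‖ ^ 2))) := by
  have h := (GaussianFourier.integrable_cexp_neg_mul_sq_norm_add (b := (b : ℂ))
    (by simpa using hb) 0 (0 : EuclideanSpace ℝ (Fin d))).norm
  refine h.congr (Eventually.of_forall fun v => ?_)
  have : (-(b : ℂ) * (‖v‖ : ℂ) ^ 2) = ((-(b * ‖v‖ ^ 2) : ℝ) : ℂ) := by push_cast; ring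
  simp only [zero_mul, add_zero]
  rw [this, Complex.norm_exp, Complex.ofReal_re]

lemma gauss_integrable_shift (b : ℝ) (hb : 0 < b) (x : EuclideanSpace ℝ (Fin d)) :
    Integrable (fun v : EuclideanSpace ℝ (Fin d) => Real.exp (-(b * ‖x - v‖ ^ 2))) :=
  (gauss_integrable_aux b hb).comp_sub_left x

/-- if `G` is differentiable with locally Lipschitz gradient and the infimum
defining `M_G^t` is always attained, then `G^t_T → M_G^t` uniformly on compact sets as
`T → 0⁺`. -/
theorem diffPot_tendstoUniformlyOn_moreau
    (G : EuclideanSpace ℝ (Fin d) → ℝ) (hG0 : ∀ x, 0 ≤ G x)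
    (hGdiff : Differentiable ℝ G)
    (hGgradLip : LocallyLipschitz (fun x => gradient G x))
    (t : ℝ) (ht : 0 < t)
    (hattain : ∀ x, (proxSet G t x).Nonempty) :
    ∀ K : Set (EuclideanSpace ℝ (Fin d)), IsCompact K → ∀ ε > 0, ∃ T₀ > 0,
      ∀ T : ℝ, 0 < T → T < T₀ → ∀ x ∈ K, |diffPot G t T x - moreau G t x| ≤ ε := by
  intro K hK ε hε
  have hGc : Continuous G := hGdiff.continuous
  obtain ⟨C0, hC0⟩ := (hK.image hGc).bddAbove
  have hGK : ∀ x ∈ K, G x ≤ max C0 0 := fun x hx =>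
    (hC0 (Set.mem_image_of_mem G hx)).trans (le_max_left _ _)
  set C := max C0 0 with hC
  have hCnn : 0 ≤ C := le_max_right _ _
  obtain ⟨R0, hR0⟩ := hK.isBounded.exists_norm_le
  choose p hp using hattain
  have hmor : ∀ x, moreau G t x = G (p x) + ‖x - p x‖ ^ 2 / (2 * t) := by
    intro x
    unfold moreau
    rw [if_neg ht.ne']
    apply le_antisymm
    · exact ciInf_le ⟨_, by rintro _ ⟨y, rfl⟩; exact hp x y⟩ (p x)
    · exact le_ciInf (hp x)
  have hmle : ∀ x y, moreau G t x ≤ G y + ‖x - y‖ ^ 2 / (2 * t) := by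
    intro x y; rw [hmor]; exact hp x y
  have hmC : ∀ x ∈ K, moreau G t x ≤ C := by
    intro x hx
    have := hmle x x
    simp at this
    exact this.trans (hGK x hx)
  -- minimizers lie in a bounded set
  set R := R0 + (1 + 2 * t * C) with hR
  have hpR : ∀ x ∈ K, p x ∈ Metric.closedBall (0 : EuclideanSpace ℝ (Fin d)) R := by
    intro x hx
    have h1 := hmC x hx
    rw [hmor] at h1
    have h2 : ‖x - p x‖ ^ 2 / (2 * t) ≤ C := by linarith [hG0 (p x)]
    rw [div_le_iff₀ (by positivity)] at h2
    have h3 : ‖x - p x‖ ≤ 1 + 2 * t * C := by nlinarith [sq_nonneg (‖x - p x‖ - 1), norm_nonneg (x - p x)]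
    rw [mem_closedBall_zero_iff]
    have h4 : ‖p x‖ ≤ ‖x‖ + ‖x - p x‖ := by
      calc ‖p x‖ = ‖x - (x - p x)‖ := by congr 1; abel
        _ ≤ _ := norm_sub_le _ _
    linarith [hR0 x hx]
  -- uniform closeness
  let F : EuclideanSpace ℝ (Fin d) × EuclideanSpace ℝ (Fin d) → ℝ :=
    fun z => G z.2 + ‖z.1 - z.2‖ ^ 2 / (2 * t)
  have hF : Continuous F := by
    have h2 : Continuous fun z : EuclideanSpace ℝ (Fin d) × EuclideanSpace ℝ (Fin d) => G z.2 :=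
      hGc.comp continuous_snd
    exact h2.add (by fun_prop)
  have hS : IsCompact (K ×ˢ Metric.closedBall (0 : EuclideanSpace ℝ (Fin d)) R) :=
    hK.prod (isCompact_closedBall _ _)
  have hU := hS.uniformContinuousAt_of_continuousAt F (fun z _ => hF.continuousAt)
    (Metric.dist_mem_uniformity (half_pos hε))
  obtain ⟨r, hr, hrU⟩ := Metric.mem_uniformity_dist.1 hU
  have hclose : ∀ x ∈ K, ∀ y ∈ Metric.ball (p x) r,
      G y + ‖x - y‖ ^ 2 / (2 * t) ≤ moreau G t x + ε / 2 := by
    intro x hx y hy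
    have h1 : dist (x, p x) (x, y) < r := by
      rw [Prod.dist_eq]
      simp only [dist_self]
      rw [Metric.mem_ball, dist_comm] at hy
      exact max_lt hr hy
    have h2 := hrU h1 (Set.mk_mem_prod hx (hpR x hx))
    have h3 : dist (F (x, p x)) (F (x, y)) < ε / 2 := h2
    rw [Real.dist_eq] at h3
    have h4 := (abs_lt.1 h3).1
    simp only [F] at h4
    rw [hmor]
    linarith
  set v := volume.real (Metric.ball (0 : EuclideanSpace ℝ (Fin d)) r) with hv
  have hvpos : 0 < v := by
    rw [hv, measureReal_def]
    exact ENNReal.toReal_pos (Metric.measure_ball_pos _ _ hr).ne' measure_ball_lt_top.ne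
  set Z := ∫ y : EuclideanSpace ℝ (Fin d), Real.exp (-(1 / (2 * t) * ‖y‖ ^ 2)) with hZ
  have hZpos : 0 < Z := integral_exp_pos (gauss_integrable_aux _ (by positivity))
  -- the error terms
  set c := 2 * Real.pi * t with hc
  have hcpos : 0 < c := by positivity
  let a : ℝ → ℝ := fun T => (d : ℝ) / 2 * ((c * T) * Real.log (c * T) / c)
  have ha : Continuous a := by
    have h : Continuous fun T : ℝ => (c * T) * Real.log (c * T) :=
      Real.continuous_mul_log.comp (continuous_const.mul continuous_id)
    exact continuous_const.mul (h.div_const c)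
  have hE1 : ∀ᶠ T in 𝓝 (0 : ℝ), a T - T * Real.log v < ε / 2 := by
    have h : Continuous fun T => a T - T * Real.log v := by fun_prop
    exact h.continuousAt.eventually_lt continuousAt_const (by simpa [a] using half_pos hε)
  have hE2 : ∀ᶠ T in 𝓝 (0 : ℝ), -ε < a T - T * C - T * Real.log Z := by
    have h : Continuous fun T => a T - T * C - T * Real.log Z := by fun_prop
    exact continuousAt_const.eventually_lt h.continuousAt (by simpa [a] using hε)
  obtain ⟨δ, hδ, hball⟩ := Metric.eventually_nhds_iff.1 (hE1.and hE2)
  refine ⟨min δ 1, lt_min hδ one_pos, fun T hT hTlt x hx => ?_⟩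
  have hTδ : T < δ := hTlt.trans_le (min_le_left _ _)
  have hT1 : T < 1 := hTlt.trans_le (min_le_right _ _)
  obtain ⟨h1, h2⟩ := hball (y := T) (by rwa [Real.dist_eq, sub_zero, abs_of_pos hT])
  set M := moreau G t x with hM
  let f : EuclideanSpace ℝ (Fin d) → ℝ := fun y => G y + ‖x - y‖ ^ 2 / (2 * t)
  have hfe : ∀ y, -G y / T - ‖x - y‖ ^ 2 / (2 * T * t) = -(f y / T) := by
    intro y; simp only [f]; field_simp; ring
  have hfc : Continuous f := by
    exact hGc.add (by fun_prop)
  have hub : ∀ y, Real.exp (-(f y / T)) ≤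
      Real.exp (-((1 - T) / T * M)) * Real.exp (-(1 / (2 * t) * ‖x - y‖ ^ 2)) := by
    intro y
    rw [← Real.exp_add]
    apply Real.exp_le_exp.2
    have e1 : f y / T = (1 - T) / T * f y + f y := by field_simp; ring
    have e2 : (1 - T) / T * M ≤ (1 - T) / T * f y :=
      mul_le_mul_of_nonneg_left (hmle x y) (div_nonneg (by linarith) hT.le)
    have e3 : 1 / (2 * t) * ‖x - y‖ ^ 2 ≤ f y := by
      have : 1 / (2 * t) * ‖x - y‖ ^ 2 = ‖x - y‖ ^ 2 / (2 * t) := by ring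
      simp only [f]; linarith [hG0 y]
    linarith
  have hgi := (gauss_integrable_shift (1 / (2 * t)) (by positivity) x).const_mul
    (Real.exp (-((1 - T) / T * M)))
  have hint : Integrable (fun y => Real.exp (-(f y / T))) := by
    refine hgi.mono' (by fun_prop) (Eventually.of_forall fun y => ?_)
    rw [Real.norm_eq_abs, abs_of_pos (Real.exp_pos _)]
    exact hub y
  set I := ∫ y, Real.exp (-(f y / T)) with hI
  have hIpos : 0 < I := integral_exp_pos hint
  have hIle : I ≤ Real.exp (-((1 - T) / T * M)) * Z := by
    have h := integral_mono hint hgi hub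
    rw [integral_const_mul] at h
    rwa [integral_sub_left_eq_self (fun y : EuclideanSpace ℝ (Fin d) =>
      Real.exp (-(1 / (2 * t) * ‖y‖ ^ 2))) volume x] at h
  have hIge : Real.exp (-((M + ε / 2) / T)) * v ≤ I := by
    have h := setIntegral_ge_of_const_le_real (μ := volume) (s := Metric.ball (p x) r)
      (f := fun y => Real.exp (-(f y / T))) (c := Real.exp (-((M + ε / 2) / T)))
      measurableSet_ball measure_ball_lt_top.ne (fun y hy => by
        apply Real.exp_le_exp.2
        apply neg_le_neg
        exact div_le_div_of_nonneg_right (hclose x hx y hy) hT.le) hint.integrableOn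
    rw [Measure.addHaar_real_ball_center] at h
    exact h.trans (setIntegral_le_integral hint (Eventually.of_forall fun y => (Real.exp_pos _).le))
  have hl1 : Real.log I ≤ -((1 - T) / T * M) + Real.log Z := by
    have := Real.log_le_log hIpos hIle
    rwa [Real.log_mul (Real.exp_pos _).ne' hZpos.ne', Real.log_exp] at this
  have hl2 : -((M + ε / 2) / T) + Real.log v ≤ Real.log I := by
    have := Real.log_le_log (mul_pos (Real.exp_pos _) hvpos) hIge
    rwa [Real.log_mul (Real.exp_pos _).ne' hvpos.ne', Real.log_exp] at this
  have hD : diffPot G t T x = a T - T * Real.log I := by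
    unfold diffPot
    simp only [hfe]
    have e : 2 * Real.pi * T * t = c * T := by rw [hc]; ring
    have hcT : 0 < c * T := by positivity
    rw [e, Real.log_mul (Real.rpow_pos_of_pos hcT _).ne' hIpos.ne', Real.log_rpow hcT]
    simp only [a]
    field_simp
    ring
  have m1 : T * Real.log I ≤ -((1 - T) * M) + T * Real.log Z := by
    have := mul_le_mul_of_nonneg_left hl1 hT.le
    have e : T * (-((1 - T) / T * M) + Real.log Z) = -((1 - T) * M) + T * Real.log Z := by
      field_simp
    linarith
  have m2 : -(M + ε / 2) + T * Real.log v ≤ T * Real.log I := by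
    have := mul_le_mul_of_nonneg_left hl2 hT.le
    have e : T * (-((M + ε / 2) / T) + Real.log v) = -(M + ε / 2) + T * Real.log v := by
      field_simp
    linarith
  have m3 : T * M ≤ T * C := mul_le_mul_of_nonneg_left (hmC x hx) hT.le
  rw [hD, abs_le]
  constructor
  · linarith
  · linarith
end
end
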